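/- arXiv:math/0211073 — 9 statements merged into one kernel-verified Lean document; each statement's English description precedes it below -/
import Mathlib

section
/- For every n ≥ 1, every orientation in the class 𝒞_n is acyclic: it admits no directed cycle. -/
/-- Two vertices of the `n`-cube (elements of `{0,1}^n`, modeled as `Fin n → Bool`)
are adjacent iff they differ in exactly one coordinate. -/
def CubeAdj {n : ℕ} (v w : Fin n → Bool) : Prop :=
  (Finset.univ.filter fun i => v i ≠ w i).card = 1

/-- `O` is an orientation of the graph with adjacency relation `Adj`:
it directs every edge in exactly one of the two possible ways. -/
def IsOrientation {V : Type*} (Adj O : V → V → Prop) : Prop :=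
  (∀ v w, O v w → Adj v w) ∧ (∀ v w, Adj v w → (O v w ↔ ¬ O w v))

/-- The class `𝒞_n` of orientations of the `n`-cube: every edge in `E_i` with
`i ≠ n` is oriented toward the endpoint having `1` in coordinate `i`; an edge in
`E_n` is oriented toward the endpoint with `1` (resp. `0`) in the last coordinate
if its endpoints have fewer (resp. more) than `r = ⌊n/2⌋` ones among the first
`n-1` coordinates; edges in `E_n` with exactly `r` ones among the first `n-1`
coordinates may be oriented either way. -/
def ClassC (n : ℕ) (O : (Fin n → Bool) → (Fin n → Bool) → Prop) : Prop :=
  IsOrientation CubeAdj O ∧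
  ∀ v w : Fin n → Bool, CubeAdj v w → ∀ i : Fin n, v i ≠ w i →
    ((i.val ≠ n - 1 → v i = false → O v w) ∧
     (i.val = n - 1 →
       (((Finset.univ.filter fun j : Fin n => j.val ≠ n - 1 ∧ v j = true).card < n / 2 →
           v i = false → O v w) ∧
        ((Finset.univ.filter fun j : Fin n => j.val ≠ n - 1 ∧ v j = true).card > n / 2 →
           v i = true → O v w))))

section
variable {n : ℕ} {O : (Fin n → Bool) → (Fin n → Bool) → Prop} {v w : Fin n → Bool}

theorem CubeAdj.symm (h : CubeAdj v w) : CubeAdj w v := by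
  simpa only [CubeAdj, ne_comm] using h

theorem CubeAdj.ne (h : CubeAdj v w) : v ≠ w := by
  rintro rfl
  simp [CubeAdj] at h

theorem IsOrientation.asymm {V : Type*} {Adj P : V → V → Prop} (h : IsOrientation Adj P)
    {a b : V} (hab : P a b) : ¬ P b a :=
  (h.2 a b (h.1 a b hab)).1 hab

/-- Along an edge of an orientation in `𝒞_n`, no coordinate but the last one decreases. -/
theorem ClassC.le_of_rel (hO : ClassC n O) (h : O v w) {j : Fin n} (hj : j.val ≠ n - 1) :
    v j ≤ w j := by
  by_contra hlt
  obtain ⟨hw, hv⟩ : w j = false ∧ v j = true := Bool.lt_iff.1 (not_le.1 hlt)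
  exact hO.1.asymm h
    (((hO.2 w v (hO.1.1 v w h).symm j (by simp [hv, hw])).1 hj) hw)

/-- Along a directed path of an orientation in `𝒞_n`, no coordinate but the last one decreases. -/
theorem ClassC.le_of_reflTransGen (hO : ClassC n O) (h : Relation.ReflTransGen O v w)
    {j : Fin n} (hj : j.val ≠ n - 1) : v j ≤ w j := by
  induction h with
  | refl => exact le_rfl
  | tail _ hbc ih => exact ih.trans (hO.le_of_rel hbc hj)

/-- If an edge of an orientation in `𝒞_n` lies on a closed walk, its endpoints differ exactly in
the last coordinate. -/
theorem ClassC.ne_iff_of_rel_of_reflTransGen (hO : ClassC n O) (h : O v w)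
    (h' : Relation.ReflTransGen O w v) (j : Fin n) : v j ≠ w j ↔ j.val = n - 1 := by
  have agree {i : Fin n} (hi : i.val ≠ n - 1) : v i = w i :=
    le_antisymm (hO.le_of_rel h hi) (hO.le_of_reflTransGen h' hi)
  refine ⟨fun hne => by_contra fun hj => hne (agree hj), fun hj heq => ?_⟩
  refine (hO.1.1 v w h).ne (funext fun i => ?_)
  by_cases hi : i.val = n - 1
  · rwa [Fin.ext (hi.trans hj.symm)]
  · exact agree hi

end

/-- Every orientation in the class `𝒞_n` is acyclic: it admits no directed cycle. -/
theorem stmt_1 (n : ℕ) (hn : 1 ≤ n)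
    (O : (Fin n → Bool) → (Fin n → Bool) → Prop) (hO : ClassC n O) :
    ∀ v, ¬ Relation.TransGen O v v := by
  intro v hv
  obtain ⟨w, hvw, hwv⟩ := Relation.TransGen.head'_iff.1 hv
  obtain rfl | ⟨x, hwx, hxv⟩ := hwv.cases_head
  · exact (hO.1.1 _ _ hvw).ne rfl
  have hx : x = v := by
    funext j
    have h₁ := hO.ne_iff_of_rel_of_reflTransGen hvw hwv j
    have h₂ := hO.ne_iff_of_rel_of_reflTransGen hwx (hxv.tail hvw) j
    cases hj : v j <;> cases hj' : w j <;> cases hj'' : x j <;> simp_all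
  exact hO.1.asymm hvw (hx ▸ hwx)
end

section
/- For every n ≥ 1, every orientation O in the class 𝒞_n, every k ≥ 1, and every k-face F of Q_n with source u and sink v (with respect to O), there exist k directed paths in F from u to v that are pairwise disjoint except at their endpoints. -/
/-- `l` is a directed path (w.r.t. orientation `O`) inside the vertex set `F`
from `u` to `v`: a nonempty list of distinct vertices of `F`, starting at `u`,
ending at `v`, with consecutive vertices joined by an edge directed from the
earlier to the later vertex. -/
def IsDirPath {V : Type*} (O : V → V → Prop) (F : Set V) (u v : V) (l : List V) : Prop :=
  l ≠ [] ∧ l.head? = some u ∧ l.getLast? = some v ∧ l.Chain' O ∧ l.Nodup ∧ ∀ x ∈ l, x ∈ F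

/-- Flipping one coordinate gives an adjacent vertex. -/
theorem cubeAdj_update {n : ℕ} (w : Fin n → Bool) (i : Fin n) :
    CubeAdj w (Function.update w i (!w i)) := by
  unfold CubeAdj
  rw [Finset.card_eq_one]
  refine ⟨i, ?_⟩
  ext j
  by_cases h : j = i
  · subst h; simp
  · simp [h]

/-- A finite set of cardinality `m` can be indexed by the naturals below `m`. -/
theorem Finset.exists_index {α : Type*} [DecidableEq α] (S : Finset α) :
    ∃ f : α → ℕ, (∀ i ∈ S, f i < S.card) ∧ (∀ i ∈ S, ∀ j ∈ S, f i = f j → i = j) ∧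
      ∀ t < S.card, ∃ i ∈ S, f i = t := by
  refine ⟨fun i => if h : i ∈ S then S.equivFin ⟨i, h⟩ else 0, ?_, ?_, ?_⟩
  · intro i hi
    simp [hi]
  · intro i hi j hj h
    simp only [hi, hj, dif_pos] at h
    simpa using S.equivFin.injective (Fin.ext h)
  · intro t ht
    refine ⟨S.equivFin.symm ⟨t, ht⟩, Subtype.prop _, ?_⟩
    simp

/-- The cyclic difference `t - a` modulo `m`, for `t, a < m`. -/
def cyclicSub (m a t : ℕ) : ℕ := if a ≤ t then t - a else t + m - a

/-- The vertex obtained from `u` by flipping the `j` coordinates of `S` which cyclically follow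
position `a` in the indexing `f`. -/
def cyclicVertex {n : ℕ} (S : Finset (Fin n)) (f : Fin n → ℕ) (u : Fin n → Bool) (a j : ℕ) :
    Fin n → Bool :=
  fun i => if i ∈ S ∧ cyclicSub S.card a (f i) < j then !u i else u i

theorem cyclicVertex_eq_iff {n : ℕ} {S : Finset (Fin n)} {f : Fin n → ℕ} {u : Fin n → Bool}
    {a j b l : ℕ} (h : cyclicVertex S f u a j = cyclicVertex S f u b l) {i : Fin n} (hi : i ∈ S) :
    cyclicSub S.card a (f i) < j ↔ cyclicSub S.card b (f i) < l := by
  have := congrFun h i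
  simp only [cyclicVertex, hi, true_and] at this
  split_ifs at this with h1 h2 h2
  · simp [h1, h2]
  · simp at this
  · simp at this
  · simp [h1, h2]

/-- If all edges of the face spanned by `S` point away from `u`, there are `S.card` directed paths
from `u` to the antipode of `u` in the face which are disjoint except at their endpoints. -/
theorem exists_disjoint_paths_of_uniform {n : ℕ} (O : (Fin n → Bool) → (Fin n → Bool) → Prop)
    (S : Finset (Fin n)) (u v : Fin n → Bool)
    (hS : ∀ i ∈ S, v i = !u i) (hS' : ∀ i ∉ S, v i = u i)
    (hO : ∀ w : Fin n → Bool, (∀ i ∉ S, w i = u i) → ∀ i ∈ S, w i = u i →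
      O w (Function.update w i (!w i))) :
    ∃ P : Fin S.card → List (Fin n → Bool),
      (∀ a, IsDirPath O {w | ∀ i ∉ S, w i = u i} u v (P a)) ∧
      (∀ a b, a ≠ b → ∀ x, x ∈ P a → x ∈ P b → x = u ∨ x = v) := by
  obtain ⟨f, hlt, hinj, hsurj⟩ := S.exists_index
  have hzero : ∀ a, cyclicVertex S f u a 0 = u := by
    intro a; ext i; simp [cyclicVertex]
  have hfull : ∀ a < S.card, cyclicVertex S f u a S.card = v := by
    intro a ha
    funext i
    by_cases hi : i ∈ S
    · have h1 : cyclicSub S.card a (f i) < S.card := by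
        have := hlt i hi
        unfold cyclicSub; split_ifs <;> omega
      simp [cyclicVertex, hi, h1, hS i hi]
    · simp [cyclicVertex, hi, hS' i hi]
  have hoff : ∀ a j, ∀ i ∉ S, cyclicVertex S f u a j i = u i := by
    intro a j i hi
    simp [cyclicVertex, hi]
  refine ⟨fun a => (List.range (S.card + 1)).map (cyclicVertex S f u a), ?_, ?_⟩
  · intro a
    refine ⟨by simp, ?_, ?_, ?_, ?_, ?_⟩
    · simp [List.range_succ_eq_map, hzero]
    · simp [List.range_succ, hfull a a.2]
    · rw [List.Chain', List.isChain_map, List.isChain_range]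
      intro j hj
      have hj : j < S.card := by omega
      have ha := a.2
      obtain ⟨i, hi, hfi⟩ := hsurj (if a + j < S.card then a + j else a + j - S.card)
        (by split_ifs <;> omega)
      have hidx : cyclicSub S.card a (f i) = j := by
        rw [hfi]; unfold cyclicSub; split_ifs <;> omega
      have hi0 : cyclicVertex S f u a j i = u i := by
        simp [cyclicVertex, hidx]
      have hnext : cyclicVertex S f u a (j + 1) =
          Function.update (cyclicVertex S f u a j) i (!cyclicVertex S f u a j i) := by
        funext l
        by_cases hl : l = i
        · subst hl
          simp [hi0]
          simp [cyclicVertex, hidx, hi]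
        · rw [Function.update_of_ne hl]
          by_cases hlS : l ∈ S
          · have hne : cyclicSub S.card a (f l) ≠ j := by
              intro h
              apply hl
              apply hinj l hlS i hi
              have := hlt l hlS
              have := hlt i hi
              unfold cyclicSub at h hidx
              split_ifs at h hidx <;> omega
            have : cyclicSub S.card a (f l) < j + 1 ↔ cyclicSub S.card a (f l) < j := by omega
            simp [cyclicVertex, this]
          · simp [cyclicVertex, hlS]
      rw [hnext]
      exact hO _ (hoff _ _) i hi hi0
    · apply List.Nodup.map_on _ List.nodup_range
      have key : ∀ j l, j < l → l ≤ S.card →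
          cyclicVertex S f u a j ≠ cyclicVertex S f u a l := by
        intro j l hjl hl h
        have ha := a.2
        obtain ⟨i, hi, hfi⟩ := hsurj (if a + j < S.card then a + j else a + j - S.card)
          (by split_ifs <;> omega)
        have hidx : cyclicSub S.card a (f i) = j := by
          rw [hfi]; unfold cyclicSub; split_ifs <;> omega
        have := cyclicVertex_eq_iff h hi
        omega
      intro j hj l hl h
      simp only [List.mem_range] at hj hl
      rcases lt_trichotomy j l with hjl | hjl | hjl
      · exact absurd h (key j l hjl (by omega))
      · exact hjl
      · exact absurd h.symm (key l j hjl (by omega))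
    · intro x hx
      obtain ⟨j, -, rfl⟩ := List.mem_map.1 hx
      exact hoff _ _
  · intro a b hab x hxa hxb
    obtain ⟨j, hj, rfl⟩ := List.mem_map.1 hxa
    obtain ⟨l, hl, h⟩ := List.mem_map.1 hxb
    simp only [List.mem_range] at hj hl
    have ha := a.2
    have hb := b.2
    have hab : (a : ℕ) ≠ b := fun h => hab (Fin.ext h)
    rcases Nat.eq_zero_or_pos j with rfl | hj0
    · exact Or.inl (hzero _)
    rcases Nat.lt_or_ge j S.card with hjS | hjS
    swap
    · obtain rfl : j = S.card := by omega
      exact Or.inr (hfull _ ha)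
    rcases Nat.eq_zero_or_pos l with rfl | hl0
    · exact Or.inl (h.symm.trans (hzero _))
    rcases Nat.lt_or_ge l S.card with hlS | hlS
    swap
    · obtain rfl : l = S.card := by omega
      exact Or.inr (h.symm.trans (hfull _ hb))
    exfalso
    obtain ⟨i, hi, hfi⟩ := hsurj b hb
    obtain ⟨i', hi', hfi'⟩ := hsurj (if (b : ℕ) = 0 then S.card - 1 else b - 1)
      (by split_ifs <;> omega)
    have h1 := cyclicVertex_eq_iff h hi
    have h2 := cyclicVertex_eq_iff h hi'
    rw [hfi] at h1
    rw [hfi'] at h2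
    unfold cyclicSub at h1 h2
    split_ifs at h1 h2 <;> omega

/-- For every `n ≥ 1`, every orientation `O ∈ 𝒞_n`, every `k ≥ 1` and every
`k`-face `F` of `Q_n` with source `u` and sink `v`, there exist `k` directed
paths in `F` from `u` to `v`, pairwise disjoint except at their endpoints. -/
theorem stmt_3 (n : ℕ) (hn : 1 ≤ n)
    (O : (Fin n → Bool) → (Fin n → Bool) → Prop) (hO : ClassC n O)
    (k : ℕ) (hk : 1 ≤ k) (I : Finset (Fin n)) (hI : I.card = k) (φ : Fin n → Bool)
    (u v : Fin n → Bool)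
    (huF : ∀ i ∉ I, u i = φ i)
    (hu : ∀ w : Fin n → Bool, (∀ i ∉ I, w i = φ i) → ¬ O w u)
    (hvF : ∀ i ∉ I, v i = φ i)
    (hv : ∀ w : Fin n → Bool, (∀ i ∉ I, w i = φ i) → ¬ O v w) :
    ∃ P : Fin k → List (Fin n → Bool),
      (∀ a, IsDirPath O {w | ∀ i ∉ I, w i = φ i} u v (P a)) ∧
      (∀ a b, a ≠ b → ∀ x, x ∈ P a → x ∈ P b → x = u ∨ x = v) := by
  obtain ⟨⟨-, hor⟩, hC⟩ := hO
  have hflip : ∀ w : Fin n → Bool, (∀ i ∉ I, w i = φ i) → ∀ i ∈ I,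
      ∀ j ∉ I, Function.update w i (!w i) j = φ j := by
    intro w hw i hi j hj
    rw [Function.update_of_ne (by rintro rfl; exact hj hi), hw j hj]
  have hback : ∀ (w : Fin n → Bool) (i : Fin n), ¬ O w (Function.update w i (!w i)) →
      O (Function.update w i (!w i)) w := by
    intro w i h
    by_contra h'
    exact h ((hor _ _ (cubeAdj_update w i)).2 h')
  have huout : ∀ i ∈ I, O u (Function.update u i (!u i)) := fun i hi =>
    by_contra fun h => hu _ (hflip u huF i hi) (hback u i h)
  have hvin : ∀ i ∈ I, O (Function.update v i (!v i)) v := fun i hi =>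
    hback v i (hv _ (hflip v hvF i hi))
  have hup : ∀ w : Fin n → Bool, ∀ i : Fin n, i.val ≠ n - 1 → w i = false →
      O w (Function.update w i (!w i)) := fun w i hi hw =>
    (hC w _ (cubeAdj_update w i) i (by simp)).1 hi hw
  have hufalse : ∀ i ∈ I, i.val ≠ n - 1 → u i = false := by
    intro i hi hin
    by_contra h
    have h := hup (Function.update u i (!u i)) i hin (by simpa using h)
    simp only [Function.update_self, Bool.not_not, Function.update_idem,
      Function.update_eq_self] at h
    exact hu _ (hflip u huF i hi) h
  have hvtrue : ∀ i ∈ I, i.val ≠ n - 1 → v i = true := by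
    intro i hi hin
    by_contra h
    exact hv _ (hflip v hvF i hi) (hup v i hin (by simpa using h))
  by_cases hlast : ∃ i ∈ I, i.val = n - 1 ∧ v i = u i
  · obtain ⟨L, hL, hLn, hvu⟩ := hlast
    have hne : ∀ i, i ≠ L → i.val ≠ n - 1 := fun i hi h => hi (Fin.ext (h.trans hLn.symm))
    obtain ⟨m, rfl⟩ : ∃ m, k = m + 1 := ⟨k - 1, by omega⟩
    have hcard : (I.erase L).card = m := by rw [Finset.card_erase_of_mem hL]; omega
    have huv : ∀ i ∈ I.erase L, v i = !u i := fun i hi => by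
      have hiI := Finset.mem_of_mem_erase hi
      have hin := hne i (Finset.ne_of_mem_erase hi)
      rw [hvtrue i hiI hin, hufalse i hiI hin]; rfl
    have huv' : ∀ i ∉ I.erase L, v i = u i := fun i hi => by
      by_cases h : i = L
      · rw [h, hvu]
      · rw [hvF i (by simpa [h] using hi), huF i (by simpa [h] using hi)]
    have hmpos : 0 < m := by
      rw [← hcard, Finset.card_pos, Finset.nonempty_iff_ne_empty]
      intro h
      have : v = u := funext fun i => huv' i (by simp [h])
      subst this
      exact hv _ (hflip v hvF L hL) (huout L hL)
    have hune : u ≠ v := by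
      obtain ⟨i, hi⟩ := Finset.card_pos.1 (hcard ▸ hmpos)
      intro h
      have := huv i hi
      simp [h] at this
    obtain ⟨P, hP, hPd⟩ := exists_disjoint_paths_of_uniform O (I.erase L) u v huv huv'
      (fun w _ i hi hwi => hup w i (hne i (Finset.ne_of_mem_erase hi)) (hwi.trans
        (hufalse i (Finset.mem_of_mem_erase hi) (hne i (Finset.ne_of_mem_erase hi)))))
    obtain ⟨Q, hQ, -⟩ := exists_disjoint_paths_of_uniform O (I.erase L)
      (Function.update u L (!u L)) (Function.update v L (!v L))
      (fun i hi => by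
        have := Finset.ne_of_mem_erase hi
        simp [this, huv i hi])
      (fun i hi => by
        by_cases h : i = L
        · subst h; simp [hvu]
        · simp [h, huv' i hi])
      (fun w _ i hi hwi => hup w i (hne i (Finset.ne_of_mem_erase hi)) (by
        rw [hwi, Function.update_of_ne (Finset.ne_of_mem_erase hi)]
        exact hufalse i (Finset.mem_of_mem_erase hi) (hne i (Finset.ne_of_mem_erase hi))))
    subst hcard
    obtain ⟨hQ1, hQ2, hQ3, hQ4, hQ5, hQ6⟩ := hQ ⟨0, hmpos⟩
    generalize Q ⟨0, hmpos⟩ = q at hQ1 hQ2 hQ3 hQ4 hQ5 hQ6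
    have hqL : ∀ x ∈ q, x L = !u L := fun x hx => by
      have := hQ6 x hx L (by simp)
      simpa using this
    have hPL : ∀ a, ∀ x ∈ P a, x L = u L := fun a x hx =>
      (hP a).2.2.2.2.2 x hx L (by simp)
    have huq : u ∉ q := fun h => by have := hqL u h; simp at this
    have hvq : v ∉ q := fun h => by have := hqL v h; simp [hvu] at this
    have hcross : ∀ a x, x ∈ P a → x ∈ u :: (q ++ [v]) → x = u ∨ x = v := by
      intro a x hx hxq
      simp only [List.mem_cons, List.mem_append, List.not_mem_nil, or_false] at hxq
      rcases hxq with h | h | h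
      · exact Or.inl h
      · have h1 := hqL x h
        rw [hPL a x hx] at h1
        simp at h1
      · exact Or.inr h
    refine ⟨Fin.cases (u :: (q ++ [v])) P, ?_, ?_⟩
    · intro a
      refine Fin.cases ?_ (fun a => ?_) a
      · refine ⟨by simp, by simp, by simp [List.getLast?_cons], ?_, ?_, ?_⟩
        · simp only [Fin.cases_zero]
          rw [List.Chain', List.isChain_cons, List.isChain_append]
          refine ⟨?_, hQ4, by simp, ?_⟩
          · intro y hy
            rw [List.head?_append, hQ2] at hy
            simp at hy
            subst hy
            exact huout L hL
          · intro x hx y hy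
            rw [hQ3] at hx
            simp at hx hy
            subst hx hy
            exact hvin L hL
        · simp only [Fin.cases_zero]
          simp [List.nodup_append, hQ5, huq, hune]
          rintro x hx rfl
          exact hvq hx
        · simp only [Fin.cases_zero]
          intro x hx i hi
          have hiL : i ≠ L := by rintro rfl; exact hi hL
          simp only [List.mem_cons, List.mem_append, List.not_mem_nil, or_false] at hx
          rcases hx with rfl | hx | rfl
          · exact huF i hi
          · rw [hQ6 x hx i (by simp [hi]), Function.update_of_ne hiL, huF i hi]
          · exact hvF i hi
      · obtain ⟨h1, h2, h3, h4, h5, h6⟩ := hP a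
        refine ⟨h1, h2, h3, h4, h5, ?_⟩
        intro x hx i hi
        rw [h6 x hx i (by simp [hi]), huF i hi]
    · intro a b
      refine Fin.cases ?_ (fun a => ?_) a <;> refine Fin.cases ?_ (fun b => ?_) b
      · intro h; exact absurd rfl h
      · intro _ x hxa hxb
        exact hcross b x hxb hxa
      · intro _ x hxa hxb
        exact hcross a x hxa hxb
      · intro hab x hxa hxb
        exact hPd a b (fun h => hab (by rw [h])) x hxa hxb
  · push Not at hlast
    subst hI
    have hset : {w : Fin n → Bool | ∀ i ∉ I, w i = φ i} = {w | ∀ i ∉ I, w i = u i} := by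
      ext w
      exact forall₂_congr fun i hi => by rw [huF i hi]
    rw [hset]
    apply exists_disjoint_paths_of_uniform
    · intro i hi
      by_cases hin : i.val = n - 1
      · have := hlast i hi hin
        revert this
        cases v i <;> cases u i <;> simp
      · rw [hufalse i hi hin, hvtrue i hi hin]; rfl
    · intro i hi
      rw [huF i hi, hvF i hi]
    intro w hw i hi hwi
    by_cases hin : i.val = n - 1
    swap
    · exact hup w i hin (hwi.trans (hufalse i hi hin))
    have hne : ∀ j, j ≠ i → j.val ≠ n - 1 := fun j hj h => hj (Fin.ext (h.trans hin.symm))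
    have hcount : ∀ x y : Fin n → Bool, (∀ j, j ≠ i → x j = true → y j = true) →
        (Finset.univ.filter fun j : Fin n => j.val ≠ n - 1 ∧ x j = true).card ≤
          (Finset.univ.filter fun j : Fin n => j.val ≠ n - 1 ∧ y j = true).card ∧
        ((Finset.univ.filter fun j : Fin n => j.val ≠ n - 1 ∧ x j = true).card =
          (Finset.univ.filter fun j : Fin n => j.val ≠ n - 1 ∧ y j = true).card →
          ∀ j, j ≠ i → x j = y j) := by
      intro x y hxy
      have hsub : (Finset.univ.filter fun j : Fin n => j.val ≠ n - 1 ∧ x j = true) ⊆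
          (Finset.univ.filter fun j : Fin n => j.val ≠ n - 1 ∧ y j = true) := by
        intro j hj
        simp only [Finset.mem_filter, Finset.mem_univ, true_and] at hj ⊢
        exact ⟨hj.1, hxy j (by rintro rfl; exact hj.1 hin) hj.2⟩
      refine ⟨Finset.card_le_card hsub, fun h j hj => ?_⟩
      have := Finset.ext_iff.1 (Finset.eq_of_subset_of_card_le hsub h.ge) j
      simp only [Finset.mem_filter, Finset.mem_univ, true_and, hne j hj, ne_eq,
        not_false_eq_true] at this
      exact Bool.eq_iff_iff.2 this
    obtain ⟨huw, huw'⟩ := hcount u w fun j hj h => by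
      by_cases hjI : j ∈ I
      · rw [hufalse j hjI (hne j hj)] at h; cases h
      · rw [hw j hjI, h]
    obtain ⟨hwv, hwv'⟩ := hcount w v fun j hj h => by
      by_cases hjI : j ∈ I
      · exact hvtrue j hjI (hne j hj)
      · rw [hvF j hjI, ← huF j hjI, ← hw j hjI, h]
    have hvi : v i = !u i := by
      have := hlast i hi hin
      revert this
      cases v i <;> cases u i <;> simp
    obtain ⟨hw1, hw2⟩ := (hC w _ (cubeAdj_update w i) i (by simp)).2 hin
    cases hui : u i
    · rw [hui] at hwi hvi
      have hv2 := ((hC v _ (cubeAdj_update v i) i (by simp)).2 hin).2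
      have hle := not_lt.1 fun h => hv _ (hflip v hvF i hi) (hv2 h hvi)
      rcases lt_or_ge (Finset.univ.filter fun j : Fin n => j.val ≠ n - 1 ∧ w j = true).card (n / 2)
        with h | h
      · exact hw1 h hwi
      · have hwv := hwv' (le_antisymm hwv (hle.trans h))
        have h1 : Function.update v i (!v i) = w := by
          funext j
          by_cases hj : j = i
          · subst hj; simp [hvi, hwi]
          · simp [hj, hwv j hj]
        have h2 : Function.update w i (!w i) = v := by
          funext j
          by_cases hj : j = i
          · subst hj; simp [hvi, hwi]
          · simp [hj, hwv j hj]
        have := hvin i hi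
        rwa [h1, ← h2] at this
    · rw [hui] at hwi
      rcases lt_or_ge (n / 2) (Finset.univ.filter fun j : Fin n => j.val ≠ n - 1 ∧ w j = true).card
        with h | h
      · exact hw2 h hwi
      · have hu1 := ((hC _ u (by
          unfold CubeAdj
          have := cubeAdj_update u i
          unfold CubeAdj at this
          simpa only [ne_comm] using this : CubeAdj (Function.update u i (!u i)) u) i
            (by simp)).2 hin).1
        have hcu := (hcount (Function.update u i (!u i)) u
          fun j hj h => by simpa [hj] using h).1
        have hge := not_lt.1 fun h => hu _ (hflip u huF i hi)
          (hu1 (hcu.trans_lt h) (by simp [hui]))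
        have huw := huw' (le_antisymm huw (h.trans hge))
        have : w = u := by
          funext j
          by_cases hj : j = i
          · subst hj; rw [hui, hwi]
          · exact (huw j hj).symm
        rw [this]
        exact huout i hi
end

section
/- Let O be an acyclic orientation of X_d, and let ℓ and ℓ' be two labelings compatible with O. Then ℓ and ℓ' induce the same pair sequence: the family of blocks {ℓ(P_i) : 1 ≤ i ≤ d} equals the family {ℓ'(P_i) : 1 ≤ i ≤ d}. -/
/-- Two vertices of the `d`-dimensional crosspolytope `X_d` (elements of
`Fin d × Bool`; the vertices `(i, true)` and `(i, false)` form the pair `P_i`)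
are adjacent iff their first coordinates differ. -/
def XAdj {d : ℕ} (x y : Fin d × Bool) : Prop := x.1 ≠ y.1

/-- An orientation is acyclic if it admits no directed cycle. -/
def IsAcyclic {V : Type*} (O : V → V → Prop) : Prop :=
  ∀ v, ¬ Relation.TransGen O v v

/-- A labeling of the vertices of `X_d` with `{0, …, 2d-1}` compatible with the
orientation `O`: a bijection onto `{0, …, 2d-1}` (an injection with all values
`< 2d`) such that every edge is directed toward its endpoint with the larger
label. -/
def IsLabeling {d : ℕ} (O : Fin d × Bool → Fin d × Bool → Prop)
    (ℓ : Fin d × Bool → ℕ) : Prop :=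
  Function.Injective ℓ ∧ (∀ x, ℓ x < 2 * d) ∧ ∀ x y, O x y → ℓ x < ℓ y

/-- A label is the number of vertices carrying a smaller label. -/
theorem IsLabeling.card_filter_lt {d : ℕ} {O : Fin d × Bool → Fin d × Bool → Prop}
    {ℓ : Fin d × Bool → ℕ} (h : IsLabeling O ℓ) (v : Fin d × Bool) :
    (Finset.univ.filter fun x => ℓ x < ℓ v).card = ℓ v := by
  have himage : Finset.univ.image ℓ = Finset.range (2 * d) := by
    refine Finset.eq_of_subset_of_card_le (fun n hn => ?_) ?_
    · obtain ⟨x, -, rfl⟩ := Finset.mem_image.mp hn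
      exact Finset.mem_range.mpr (h.2.1 x)
    · simp [Finset.card_image_of_injective _ h.1, mul_comm]
  have hlt : (Finset.univ.filter fun x => ℓ x < ℓ v).image ℓ = Finset.range (ℓ v) := by
    ext n
    simp only [Finset.mem_image, Finset.mem_filter, Finset.mem_univ, true_and, Finset.mem_range]
    constructor
    · rintro ⟨x, hx, rfl⟩
      exact hx
    · intro hn
      have hmem : n ∈ Finset.univ.image ℓ :=
        himage ▸ Finset.mem_range.mpr (hn.trans (h.2.1 v))
      obtain ⟨x, -, rfl⟩ := Finset.mem_image.mp hmem
      exact ⟨x, hn, rfl⟩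
  rw [← Finset.card_image_of_injective _ h.1, hlt, Finset.card_range]

/-- Labels of adjacent vertices are ordered as the orientation prescribes. -/
theorem IsLabeling.lt_iff {d : ℕ} {O : Fin d × Bool → Fin d × Bool → Prop}
    {ℓ : Fin d × Bool → ℕ} (h : IsLabeling O ℓ) (hor : IsOrientation XAdj O)
    {x v : Fin d × Bool} (hxv : XAdj x v) : ℓ x < ℓ v ↔ O x v := by
  refine ⟨fun hlt => ?_, h.2.2 x v⟩
  rw [hor.2 x v hxv]
  exact fun hvx => hlt.asymm (h.2.2 v x hvx)

open Classical in
/-- A label is the in-degree of its vertex, plus one if the antipodal vertex has a smaller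
label. -/
theorem IsLabeling.eq_card_add {d : ℕ} {O : Fin d × Bool → Fin d × Bool → Prop}
    {ℓ : Fin d × Bool → ℕ} (h : IsLabeling O ℓ) (hor : IsOrientation XAdj O) (v : Fin d × Bool) :
    ℓ v = (Finset.univ.filter fun x => O x v).card + if ℓ (v.1, !v.2) < ℓ v then 1 else 0 := by
  have hmem : ∀ x, ℓ x < ℓ v ↔ O x v ∨ (x = (v.1, !v.2) ∧ ℓ (v.1, !v.2) < ℓ v) := by
    intro x
    by_cases hx : x.1 = v.1
    · have hO : ¬ O x v := fun hO => hor.1 x v hO hx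
      obtain ⟨i, a⟩ := x
      obtain ⟨j, b⟩ := v
      obtain rfl : i = j := hx
      cases a <;> cases b <;> simp [hO]
    · rw [h.lt_iff hor hx]
      refine ⟨Or.inl, ?_⟩
      rintro (hO | ⟨rfl, -⟩)
      · exact hO
      · exact absurd rfl hx
  have hdisj : Disjoint (Finset.univ.filter fun x => O x v)
      (Finset.univ.filter fun x => x = (v.1, !v.2) ∧ ℓ (v.1, !v.2) < ℓ v) := by
    refine Finset.disjoint_filter.mpr ?_
    rintro x - hO ⟨rfl, -⟩
    exact hor.1 _ _ hO rfl
  refine (h.card_filter_lt v).symm.trans ?_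
  rw [Finset.filter_congr fun x _ => hmem x, Finset.filter_or,
    Finset.card_union_of_disjoint hdisj]
  congr 1
  split_ifs with hlt <;> simp [hlt, Finset.filter_eq']

/-- Let `O` be an acyclic orientation of `X_d` and let `ℓ, ℓ'` be two labelings
compatible with `O`. Then `ℓ` and `ℓ'` induce the same pair sequence: the family
of blocks `{ℓ(P_i)}` equals the family `{ℓ'(P_i)}`. -/
theorem stmt_7 (d : ℕ) (O : Fin d × Bool → Fin d × Bool → Prop)
    (hor : IsOrientation XAdj O) (hac : IsAcyclic O)
    (ℓ ℓ' : Fin d × Bool → ℕ) (hℓ : IsLabeling O ℓ) (hℓ' : IsLabeling O ℓ') :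
    Finset.image (fun i : Fin d => ({ℓ (i, true), ℓ (i, false)} : Finset ℕ)) Finset.univ =
    Finset.image (fun i : Fin d => ({ℓ' (i, true), ℓ' (i, false)} : Finset ℕ)) Finset.univ := by
  refine Finset.image_congr fun i _ => ?_
  have ht := hℓ.eq_card_add hor (i, true)
  have hf := hℓ.eq_card_add hor (i, false)
  have ht' := hℓ'.eq_card_add hor (i, true)
  have hf' := hℓ'.eq_card_add hor (i, false)
  simp only [Bool.not_true, Bool.not_false] at ht hf ht' hf'
  have hne : ℓ (i, true) ≠ ℓ (i, false) := hℓ.1.ne (by simp)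
  have hne' : ℓ' (i, true) ≠ ℓ' (i, false) := hℓ'.1.ne (by simp)
  have key : (ℓ (i, true) = ℓ' (i, true) ∧ ℓ (i, false) = ℓ' (i, false)) ∨
      (ℓ (i, true) = ℓ' (i, false) ∧ ℓ (i, false) = ℓ' (i, true)) := by
    split_ifs at ht hf ht' hf' <;> omega
  rcases key with ⟨h₁, h₂⟩ | ⟨h₁, h₂⟩
  · simp only [h₁, h₂]
  · simp only [h₁, h₂, Finset.pair_comm]
end

section
/- Let d ≥ 2 and let π be a good pair partition of {1,…,2d}. Let π' be the pair partition of {1,…,2d−2} obtained by deleting from π the block whose smaller element is largest and relabeling the remaining 2d−2 elements by the unique order-preserving bijection onto {1,…,2d−2}. Then π' is good. -/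
/-- A pair partition of `{1, …, 2d}` (modeled as `Fin (2*d)`), encoded as a
fixed-point-free involution `f`; the blocks are the pairs `{x, f x}`. -/
def IsPairPartition (d : ℕ) (f : Fin (2 * d) → Fin (2 * d)) : Prop :=
  Function.Involutive f ∧ ∀ x, f x ≠ x

/-- A pair partition (with blocks listed in increasing order of their smaller
elements) is good if for no `k` with `0 < k < d` the union of the first `k`
blocks equals `{1, …, 2k}`; equivalently, for every such `k` some block meets
both `{1, …, 2k}` and its complement. -/
def IsGood (d : ℕ) (f : Fin (2 * d) → Fin (2 * d)) : Prop :=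
  ∀ k : ℕ, 0 < k → k < d → ∃ x : Fin (2 * d), x.val < 2 * k ∧ ¬ (f x).val < 2 * k

theorem StrictMono.fin_val_le_val {m n : ℕ} {φ : Fin m → Fin n} (hφ : StrictMono φ)
    (i : Fin m) : i.val ≤ (φ i).val := by
  obtain ⟨i, hi⟩ := i
  induction i with
  | zero => exact Nat.zero_le _
  | succ i ih =>
    have hlt : φ ⟨i, by omega⟩ < φ ⟨i + 1, hi⟩ := hφ (Nat.lt_succ_self i)
    have := ih (by omega)
    simp only [Fin.lt_def] at *
    omega

/-- A strictly increasing map between finite ordinals fixes every position below a bound `c`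
such that its range contains everything below `c`. -/
theorem StrictMono.fin_val_eq_val {m n c : ℕ} {φ : Fin m → Fin n} (hφ : StrictMono φ)
    (hc : ∀ x : Fin n, x.val < c → x ∈ Set.range φ) (hcn : c ≤ n)
    (i : Fin m) (hi : i.val < c) : (φ i).val = i.val := by
  induction i using WellFoundedLT.induction with
  | _ i ih =>
    obtain ⟨j, hj⟩ := hc ⟨i.val, by omega⟩ hi
    have hval : (φ j).val = i.val := congrArg Fin.val hj
    have hle := hφ.fin_val_le_val j
    rcases (show j ≤ i by rw [Fin.le_def]; omega).eq_or_lt with rfl | hlt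
    · exact hval
    · have := ih j hlt (by omega)
      rw [Fin.lt_def] at hlt
      omega

/-- Let `d ≥ 2` and let `π` (encoded by the involution `f`) be a good pair
partition of `{1, …, 2d}`. Delete from `π` the block `{b, f b}` whose smaller
element `b` is largest, and relabel the remaining `2d - 2` elements by the unique
order-preserving bijection `φ` onto `{1, …, 2d-2}`; the resulting pair partition
`π'` of `{1, …, 2d-2}` (encoded by the involution `f'`) is good. -/
theorem stmt_10 (d : ℕ) (hd : 2 ≤ d)
    (f : Fin (2 * d) → Fin (2 * d))
    (hf : IsPairPartition d f) (hgood : IsGood d f)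
    (b : Fin (2 * d)) (hb : b < f b) (hbmax : ∀ y, y < f y → y ≤ b)
    (f' : Fin (2 * (d - 1)) → Fin (2 * (d - 1))) (hf' : IsPairPartition (d - 1) f')
    (φ : Fin (2 * (d - 1)) → Fin (2 * d)) (hφ : StrictMono φ)
    (hrange : Set.range φ = {x : Fin (2 * d) | x ≠ b ∧ x ≠ f b})
    (hcomm : ∀ i, φ (f' i) = f (φ i)) :
    IsGood (d - 1) f' := by
  intro k hk hkd
  by_contra! hbad
  have hfb : b.val < (f b).val := hb
  rcases le_or_gt (2 * k) b.val with hkb | hbk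
  · have hsurj : ∀ x : Fin (2 * d), x.val < 2 * k → x ∈ Set.range φ := by
      intro x hx
      rw [hrange]
      constructor <;> rintro rfl <;> omega
    obtain ⟨x, hx, hfx⟩ := hgood k hk (by omega)
    obtain ⟨j, rfl⟩ := hsurj x hx
    have hj := hbad j ((hφ.fin_val_le_val j).trans_lt hx)
    rw [← hcomm, hφ.fin_val_eq_val hsurj (by omega) _ hj] at hfx
    exact hfx hj
  · have hlarge : ∀ i : Fin (2 * (d - 1)), 2 * k ≤ i.val → b < φ i := by
      intro i hi
      have := hφ.fin_val_le_val i
      rw [Fin.lt_def]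
      omega
    let j : Fin (2 * (d - 1)) := ⟨2 * k, by omega⟩
    have hj : b < φ j := hlarge j le_rfl
    have hfj : b < f (φ j) := by
      rw [← hcomm]
      refine hlarge _ (not_lt.mp fun h => ?_)
      have := hbad _ h
      rw [hf'.1 j] at this
      exact lt_irrefl _ this
    rcases lt_or_gt_of_ne (hf.2 (φ j)) with h | h
    · exact (hbmax (f (φ j)) (by rwa [hf.1 (φ j)])).not_gt hfj
    · exact (hbmax (φ j) h).not_gt hj
end

section
/- For d ≥ 1, let a_d denote the number of good pair partitions of {1,…,2d}. Then (2d−1)!! = a_d + Σ_{k=1}^{d−1} a_k · (2(d−k)−1)!!, where (2m−1)!! = (2m−1)(2m−3)···3·1 is the total number of pair partitions of a 2m-element set. -/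
/-- `goodCount d` is `a_d`, the number of good pair partitions of `{1, …, 2d}`. -/
noncomputable def goodCount (d : ℕ) : ℕ :=
  Nat.card {f : Fin (2 * d) → Fin (2 * d) // IsPairPartition d f ∧ IsGood d f}

open Finset Nat in
/-- A set of `2 * d` elements has `(2 * d - 1)‼` fixed-point-free involutions. -/
theorem card_isPairPartition (d : ℕ) :
    Nat.card {f : Fin (2 * d) → Fin (2 * d) // IsPairPartition d f} = (2 * d - 1)‼ := by
  classical
  let e : {f : Fin (2 * d) → Fin (2 * d) // IsPairPartition d f} ≃
      {σ : Equiv.Perm (Fin (2 * d)) // σ.cycleType = Multiset.replicate d 2} :=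
    { toFun f := ⟨f.2.1.toPerm, by
        have hpow : (f.2.1.toPerm : Equiv.Perm (Fin (2 * d))) ^ 2 = 1 := by
          ext x
          simp [sq, f.2.1 x]
        have hsupp : (f.2.1.toPerm : Equiv.Perm (Fin (2 * d))).support = univ := by
          ext x
          simp [f.2.2 x]
        have hrep := Equiv.Perm.cycleType_of_pow_prime_eq_one hpow
        have hsum := Equiv.Perm.sum_cycleType (f.2.1.toPerm)
        rw [hrep, hsupp, Multiset.sum_replicate, Finset.card_univ, Fintype.card_fin,
          smul_eq_mul] at hsum
        rw [hrep]
        congr 1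
        omega⟩
      invFun σ := ⟨σ.1, by
        have hpow : σ.1 ^ 2 = 1 := by
          rw [Equiv.Perm.pow_prime_eq_one_iff, σ.2]
          exact fun _ ↦ Multiset.eq_of_mem_replicate
        refine ⟨fun x ↦ ?_, fun x ↦ ?_⟩
        · simpa [sq] using congrArg (fun τ : Equiv.Perm (Fin (2 * d)) ↦ τ x) hpow
        · have hsum := Equiv.Perm.sum_cycleType σ.1
          rw [σ.2, Multiset.sum_replicate, smul_eq_mul] at hsum
          rw [← Equiv.Perm.mem_support, (card_eq_iff_eq_univ σ.1.support).1 (by simp; omega)]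
          exact mem_univ x⟩
      left_inv f := rfl
      right_inv σ := by ext; rfl }
  rw [Nat.card_congr e, Nat.card_eq_fintype_card, Fintype.card_subtype]
  rcases d with - | d
  · simp [Finset.filter_singleton]
  have hcard := Equiv.Perm.card_of_cycleType_mul_eq (Fin (2 * (d + 1)))
    (Multiset.replicate (d + 1) 2)
  rw [if_pos ⟨by simp; omega, fun a ha ↦ (Multiset.eq_of_mem_replicate ha).ge⟩] at hcard
  simp only [Fintype.card_fin, Multiset.sum_replicate, smul_eq_mul, Multiset.prod_replicate,
    Multiset.toFinset_replicate, Nat.succ_ne_zero, if_false, prod_singleton,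
    Multiset.count_replicate_self] at hcard
  rw [mul_comm (d + 1) 2, Nat.sub_self, factorial_zero, one_mul, ← doubleFactorial_two_mul] at hcard
  refine Nat.eq_of_mul_eq_mul_right (doubleFactorial_pos (2 * (d + 1))) (hcard.trans ?_)
  rw [mul_comm (2 * (d + 1) - 1)‼]
  exact factorial_eq_mul_doubleFactorial (2 * d + 1)

/-- Some nonempty initial segment `{1, …, 2k}` is a union of blocks. -/
theorem exists_initialSegment_closed {d : ℕ} (f : Fin (2 * d) → Fin (2 * d)) :
    ∃ k, 0 < k ∧ ∀ x, x.val < 2 * k → (f x).val < 2 * k :=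
  ⟨d + 1, d.succ_pos, fun x _ ↦ by omega⟩

open Classical in
/-- The least `k > 0` such that `f` maps the first `2 * k` points to themselves. -/
noncomputable def firstReturn {d : ℕ} (f : Fin (2 * d) → Fin (2 * d)) : ℕ :=
  Nat.find (exists_initialSegment_closed f)

theorem firstReturn_eq_iff {d : ℕ} {f : Fin (2 * d) → Fin (2 * d)} {k : ℕ} :
    firstReturn f = k ↔ (0 < k ∧ ∀ x, x.val < 2 * k → (f x).val < 2 * k) ∧
      ∀ j, 0 < j → j < k → ∃ x : Fin (2 * d), x.val < 2 * j ∧ ¬ (f x).val < 2 * j := by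
  classical
  rw [firstReturn, Nat.find_eq_iff]
  refine and_congr_right fun _ ↦ forall_congr' fun j ↦ ?_
  push Not
  tauto

theorem firstReturn_mem_Icc {d : ℕ} (hd : 1 ≤ d) (f : Fin (2 * d) → Fin (2 * d)) :
    firstReturn f ∈ Finset.Icc 1 d := by
  classical
  exact Finset.mem_Icc.2 ⟨(Nat.find_spec (exists_initialSegment_closed f)).1,
    Nat.find_min' _ ⟨hd, fun x _ ↦ (f x).2⟩⟩

/-- The map acting as `g` on the first `2 * k` points and as `h` on the last `2 * e` points. -/
def concatMap {k e : ℕ} (g : Fin (2 * k) → Fin (2 * k)) (h : Fin (2 * e) → Fin (2 * e))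
    (x : Fin (2 * (k + e))) : Fin (2 * (k + e)) :=
  if hx : x.val < 2 * k then ⟨g ⟨x, hx⟩, by omega⟩
  else ⟨2 * k + h ⟨x - 2 * k, by omega⟩, by omega⟩

section concatMap

variable {k e : ℕ} {g : Fin (2 * k) → Fin (2 * k)} {h : Fin (2 * e) → Fin (2 * e)}

theorem concatMap_val_of_lt {x : Fin (2 * (k + e))} (hx : x.val < 2 * k) :
    (concatMap g h x).val = g ⟨x, hx⟩ := by
  simp [concatMap, hx]

theorem concatMap_val_of_not_lt {x : Fin (2 * (k + e))} (hx : ¬ x.val < 2 * k) :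
    (concatMap g h x).val = 2 * k + h ⟨x - 2 * k, by omega⟩ := by
  simp [concatMap, hx]

theorem concatMap_isPairPartition (hg : IsPairPartition k g) (hh : IsPairPartition e h) :
    IsPairPartition (k + e) (concatMap g h) := by
  refine ⟨fun x ↦ Fin.ext ?_, fun x hx ↦ ?_⟩
  · by_cases hx : x.val < 2 * k
    · have h1 := concatMap_val_of_lt (g := g) (h := h) hx
      rw [concatMap_val_of_lt (by omega)]
      simp only [h1, Fin.eta, hg.1 _]
    · have h1 := concatMap_val_of_not_lt (g := g) (h := h) hx
      rw [concatMap_val_of_not_lt (by omega)]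
      simp only [h1, Nat.add_sub_cancel_left, Fin.eta, hh.1 _]
      omega
  · by_cases hxk : x.val < 2 * k
    · refine hg.2 ⟨x, hxk⟩ (Fin.ext ?_)
      rw [← concatMap_val_of_lt (h := h) hxk, hx]
    · refine hh.2 ⟨x - 2 * k, by omega⟩ (Fin.ext ?_)
      have h1 := concatMap_val_of_not_lt (g := g) (h := h) hxk
      rw [hx] at h1
      simp only
      omega

theorem firstReturn_concatMap (hk : 0 < k) (hg : IsGood k g) :
    firstReturn (concatMap g h) = k := by
  refine firstReturn_eq_iff.2 ⟨⟨hk, fun x hx ↦ ?_⟩, fun j hj hjk ↦ ?_⟩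
  · rw [concatMap_val_of_lt hx]
    exact Fin.is_lt _
  · obtain ⟨x, hx, hgx⟩ := hg j hj hjk
    refine ⟨⟨x, by omega⟩, hx, ?_⟩
    rwa [concatMap_val_of_lt x.2]

end concatMap

section restrict

variable {k e : ℕ} {f : Fin (2 * (k + e)) → Fin (2 * (k + e))}

/-- The restriction of `f` to the first `2 * k` points. -/
def restrictInitial (hf : ∀ x, x.val < 2 * k → (f x).val < 2 * k) (x : Fin (2 * k)) :
    Fin (2 * k) :=
  ⟨f ⟨x, by omega⟩, hf _ x.2⟩

/-- The restriction of `f` to the last `2 * e` points, renumbered from `0`. -/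
def restrictFinal (hf : ∀ x, ¬ x.val < 2 * k → ¬ (f x).val < 2 * k) (x : Fin (2 * e)) :
    Fin (2 * e) :=
  ⟨f ⟨2 * k + x, by omega⟩ - 2 * k, by have := hf ⟨2 * k + x, by omega⟩ (by simp); omega⟩

theorem not_lt_of_involutive (hinv : Function.Involutive f)
    (hf : ∀ x, x.val < 2 * k → (f x).val < 2 * k) (x : Fin (2 * (k + e)))
    (hx : ¬ x.val < 2 * k) : ¬ (f x).val < 2 * k := fun hlt ↦
  hx (by simpa only [hinv x] using hf _ hlt)

theorem restrictInitial_isPairPartition (hp : IsPairPartition (k + e) f)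
    (hf : ∀ x, x.val < 2 * k → (f x).val < 2 * k) :
    IsPairPartition k (restrictInitial hf) := by
  refine ⟨fun x ↦ Fin.ext ?_, fun x hx ↦ hp.2 ⟨x, by omega⟩ (Fin.ext ?_)⟩
  · simp [restrictInitial, hp.1 _]
  · simpa [restrictInitial, Fin.ext_iff] using hx

theorem restrictFinal_isPairPartition (hp : IsPairPartition (k + e) f)
    (hf : ∀ x, ¬ x.val < 2 * k → ¬ (f x).val < 2 * k) :
    IsPairPartition e (restrictFinal hf) := by
  have hval (x : Fin (2 * e)) : 2 * k + (restrictFinal hf x).val = f ⟨2 * k + x, by omega⟩ := by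
    have := hf ⟨2 * k + x, by omega⟩ (by simp)
    simp only [restrictFinal]
    omega
  refine ⟨fun x ↦ Fin.ext ?_, fun x hx ↦ hp.2 ⟨2 * k + x, by omega⟩ (Fin.ext ?_)⟩
  · have h1 := hval (restrictFinal hf x)
    simp only [hval x, Fin.eta, hp.1 _] at h1
    omega
  · rw [← hval, hx]

theorem concatMap_restrict (hf : ∀ x, x.val < 2 * k → (f x).val < 2 * k)
    (hf' : ∀ x, ¬ x.val < 2 * k → ¬ (f x).val < 2 * k) :
    concatMap (restrictInitial hf) (restrictFinal hf') = f := by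
  funext x
  apply Fin.ext
  by_cases hx : x.val < 2 * k
  · rw [concatMap_val_of_lt hx]
    rfl
  · have hx' := hf' x hx
    have hxk : 2 * k + (x.val - 2 * k) = x := by omega
    rw [concatMap_val_of_not_lt hx]
    simp only [restrictFinal, hxk, Fin.eta]
    omega

end restrict

/-- A pair partition with first return `k` is a good pair partition of the first `2 * k` points
together with a pair partition of the remaining ones. -/
def firstReturnEquiv {k e : ℕ} (hk : 0 < k) :
    {f : Fin (2 * (k + e)) → Fin (2 * (k + e)) // IsPairPartition (k + e) f ∧ firstReturn f = k} ≃
      {g : Fin (2 * k) → Fin (2 * k) // IsPairPartition k g ∧ IsGood k g} ×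
        {h : Fin (2 * e) → Fin (2 * e) // IsPairPartition e h} where
  toFun f :=
    have hf := (firstReturn_eq_iff.1 f.2.2).1.2
    ⟨⟨restrictInitial hf, restrictInitial_isPairPartition f.2.1 hf, fun j hj hjk ↦ by
        obtain ⟨x, hx, hfx⟩ := (firstReturn_eq_iff.1 f.2.2).2 j hj hjk
        exact ⟨⟨x, by omega⟩, hx, hfx⟩⟩,
      ⟨restrictFinal (not_lt_of_involutive f.2.1.1 hf), restrictFinal_isPairPartition f.2.1 _⟩⟩
  invFun p := ⟨concatMap p.1.1 p.2.1, concatMap_isPairPartition p.1.2.1 p.2.2,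
    firstReturn_concatMap hk p.1.2.2⟩
  left_inv f :=
    have hf := (firstReturn_eq_iff.1 f.2.2).1.2
    Subtype.ext (concatMap_restrict hf (not_lt_of_involutive f.2.1.1 hf))
  right_inv p := by
    refine Prod.ext (Subtype.ext (funext fun x ↦ Fin.ext ?_))
      (Subtype.ext (funext fun x ↦ Fin.ext ?_))
    · exact concatMap_val_of_lt x.2
    · simp [restrictFinal, concatMap]

theorem card_firstReturn_eq {d k : ℕ} (hk : 0 < k) (hkd : k ≤ d) :
    Nat.card {f : Fin (2 * d) → Fin (2 * d) // IsPairPartition d f ∧ firstReturn f = k} =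
      goodCount k * Nat.doubleFactorial (2 * (d - k) - 1) := by
  obtain ⟨e, rfl⟩ := Nat.exists_eq_add_of_le hkd
  rw [Nat.card_congr (firstReturnEquiv hk), Nat.card_prod, card_isPairPartition,
    Nat.add_sub_cancel_left, goodCount]

/-- For `d ≥ 1`, `(2d-1)!! = a_d + Σ_{k=1}^{d-1} a_k * (2(d-k)-1)!!`, where
`(2m-1)!!` is the total number of pair partitions of a `2m`-element set and
`a_m` is the number of good pair partitions of `{1, …, 2m}`. -/
theorem stmt_11 (d : ℕ) (hd : 1 ≤ d) :
    Nat.doubleFactorial (2 * d - 1) =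
      goodCount d +
        ∑ k ∈ Finset.Icc 1 (d - 1), goodCount k * Nat.doubleFactorial (2 * (d - k) - 1) := by
  classical
  have hsum : Nat.doubleFactorial (2 * d - 1) =
      ∑ k ∈ Finset.Icc 1 d, goodCount k * Nat.doubleFactorial (2 * (d - k) - 1) := by
    rw [← card_isPairPartition, Nat.card_eq_fintype_card, Fintype.card_subtype,
      Finset.card_eq_sum_card_fiberwise fun f _ ↦ firstReturn_mem_Icc hd f]
    refine Finset.sum_congr rfl fun k hk ↦ ?_
    rw [Finset.mem_Icc] at hk
    rw [← card_firstReturn_eq hk.1 hk.2, Finset.filter_filter, Nat.card_eq_fintype_card,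
      Fintype.card_subtype]
  obtain ⟨n, rfl⟩ := Nat.exists_eq_add_of_le' hd
  rw [hsum, Finset.sum_Icc_succ_top (by omega), add_comm]
  simp
end

section
/- Let d ≥ 1, let p : {1,…,d} × {+,−} → ℝ^d be a realized d-crosspolytope with pairs P_i, and let f : ℝ^d → ℝ be a linear functional taking 2d distinct values on the points p(x). Then there is no k with 0 < k < d and no subset S ⊆ {1,…,d} with |S| = k such that f(p(i,ε)) < f(p(j,δ)) for all i ∈ S, j ∉ S and all signs ε, δ ∈ {+,−}; equivalently, the pair partition of {1,…,2d} obtained by labeling each point with the rank of its f-value and forming the blocks of labels of the pairs P_i is good. -/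
/-- A family of points `p : Fin d × Bool → ℝ^d` is a realized `d`-crosspolytope
with pairs `P_i = {p (i, +), p (i, -)}` if:
(i) for every set `S` of indices containing at most one of `(i, +)`, `(i, -)`
for each `i`, there is an affine functional vanishing on the points of `S` and
positive on all other points; and
(ii) every affine functional which is nonnegative on all the points and vanishes
on both members of some pair vanishes on all the points. -/
def IsRealizedCross (d : ℕ) (p : Fin d × Bool → (Fin d → ℝ)) : Prop :=
  (∀ S : Set (Fin d × Bool), (∀ i : Fin d, ¬ ((i, true) ∈ S ∧ (i, false) ∈ S)) →
    ∃ g : (Fin d → ℝ) →ᵃ[ℝ] ℝ, (∀ x ∈ S, g (p x) = 0) ∧ (∀ x ∉ S, 0 < g (p x))) ∧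
  (∀ g : (Fin d → ℝ) →ᵃ[ℝ] ℝ, (∀ x, 0 ≤ g (p x)) →
    (∃ i : Fin d, g (p (i, true)) = 0 ∧ g (p (i, false)) = 0) → ∀ x, g (p x) = 0)

/-- For a realized crosspolytope and positive weights `a` on the vertices, some affine functional
takes at the vertices the values `a`, rescaled by a positive factor on each pair. Outside of the
set `J` of pairs, the weights are instead the indicator of the transversal `ε`. -/
lemma IsRealizedCross.exists_affineMap_eq_mul_ite {d : ℕ} {p : Fin d × Bool → (Fin d → ℝ)}
    (hp : IsRealizedCross d p) {a : Fin d × Bool → ℝ} (ha : ∀ x, 0 < a x)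
    (J : Finset (Fin d)) (ε : Fin d → Bool) :
    ∃ (l : Fin d → ℝ) (g : (Fin d → ℝ) →ᵃ[ℝ] ℝ), (∀ i, 0 < l i) ∧
      ∀ i b, g (p (i, b)) = l i * if i ∈ J then a (i, b) else if b = ε i then 1 else 0 := by
  induction J using Finset.induction_on generalizing ε with
  | empty =>
    obtain ⟨g, hg₀, hg⟩ := hp.1 {x | x.2 ≠ ε x.1} (fun i => by cases h : ε i <;> simp [h])
    refine ⟨fun i => g (p (i, ε i)), g, fun i => hg _ (by simp), fun i b => ?_⟩
    by_cases h : b = ε i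
    · simp [h]
    · simpa [h] using hg₀ (i, b) h
  | insert i J hi ih =>
    obtain ⟨l, g, hl, hg⟩ := ih (Function.update ε i true)
    obtain ⟨m, h, hm, hh⟩ := ih (Function.update ε i false)
    have hs : 0 < a (i, true) / l i := div_pos (ha _) (hl i)
    have ht : 0 < a (i, false) / m i := div_pos (ha _) (hm i)
    refine ⟨fun j => if j = i then 1 else a (i, true) / l i * l j + a (i, false) / m i * m j,
      (a (i, true) / l i) • g + (a (i, false) / m i) • h, fun j => ?_, fun j b => ?_⟩
    · have := mul_pos hs (hl j)
      have := mul_pos ht (hm j)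
      dsimp only
      split_ifs <;> linarith
    · have := (hl i).ne'
      have := (hm i).ne'
      by_cases hj : j = i
      · subst hj
        cases b <;> simp [hg, hh, hi] <;> field_simp
      · simp only [AffineMap.coe_add, AffineMap.coe_smul, Pi.add_apply, Pi.smul_apply, smul_eq_mul,
          hg, hh, Finset.mem_insert, hj, false_or, if_false, Function.update_of_ne hj]
        ring

/-- For a realized crosspolytope, any positive values at the vertices are realized by an affine
functional after rescaling them by a positive factor on each pair. -/
lemma IsRealizedCross.exists_affineMap_eq_mul {d : ℕ} {p : Fin d × Bool → (Fin d → ℝ)}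
    (hp : IsRealizedCross d p) {a : Fin d × Bool → ℝ} (ha : ∀ x, 0 < a x) :
    ∃ (l : Fin d → ℝ) (g : (Fin d → ℝ) →ᵃ[ℝ] ℝ), (∀ i, 0 < l i) ∧
      ∀ i b, g (p (i, b)) = l i * a (i, b) := by
  simpa using hp.exists_affineMap_eq_mul_ite ha Finset.univ fun _ => true

/-- No affine functional is negative on a nonempty set `S` of pairs of a realized crosspolytope
and positive on a nonempty complement. -/
lemma IsRealizedCross.not_separated {d : ℕ} {p : Fin d × Bool → (Fin d → ℝ)}
    (hp : IsRealizedCross d p) {S : Finset (Fin d)} (hS : S.Nonempty) {j : Fin d} (hj : j ∉ S)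
    (u : (Fin d → ℝ) →ᵃ[ℝ] ℝ) (hneg : ∀ i ∈ S, ∀ b, u (p (i, b)) < 0)
    (hpos : ∀ i ∉ S, ∀ b, 0 < u (p (i, b))) : False := by
  have hu : ∀ x, 0 < |u (p x)| := by
    rintro ⟨i, b⟩
    by_cases hi : i ∈ S
    · exact abs_pos.2 (hneg i hi b).ne
    · exact abs_pos.2 (hpos i hi b).ne'
  obtain ⟨l, g, hl, hg⟩ := hp.exists_affineMap_eq_mul hu
  obtain ⟨i, hi, hmin⟩ := S.exists_min_image l hS
  have hval : ∀ k b, (g + l i • u) (p (k, b)) = l k * |u (p (k, b))| + l i * u (p (k, b)) := by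
    intro k b
    simp [hg]
  have hzero := hp.2 (g + l i • u) ?_ ⟨i, ?_, ?_⟩ (j, true)
  · rw [hval, abs_of_pos (hpos j hj _)] at hzero
    have := mul_pos (hl j) (hpos j hj true)
    have := mul_pos (hl i) (hpos j hj true)
    linarith
  · rintro ⟨k, b⟩
    rw [hval]
    by_cases hk : k ∈ S
    · rw [abs_of_neg (hneg k hk b)]
      nlinarith [hmin k hk, hneg k hk b]
    · have := mul_pos (hl i) (hpos k hk b)
      have := mul_pos (hl k) (hu (k, b))
      linarith
  all_goals
    rw [hval, abs_of_neg (hneg i hi _)]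
    ring

/-- Let `p` be a realized `d`-crosspolytope (`d ≥ 1`) and let `f` be a linear
functional taking `2d` distinct values on the points `p x`. Then there is no `k`
with `0 < k < d` and no `k`-element set `S` of pairs such that every point of a
pair indexed by `S` has smaller `f`-value than every point of a pair indexed
outside `S`; equivalently, the pair partition obtained by labeling each point
with the rank of its `f`-value is good. -/
theorem stmt_12 (d : ℕ) (hd : 1 ≤ d) (p : Fin d × Bool → (Fin d → ℝ))
    (hp : IsRealizedCross d p) (f : (Fin d → ℝ) →ₗ[ℝ] ℝ)
    (hf : Function.Injective fun x => f (p x)) :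
    ¬ ∃ (k : ℕ) (S : Finset (Fin d)), 0 < k ∧ k < d ∧ S.card = k ∧
        ∀ i ∈ S, ∀ j ∉ S, ∀ ε δ : Bool, f (p (i, ε)) < f (p (j, δ)) := by
  rintro ⟨k, S, hk, hkd, rfl, h⟩
  have hS : S.Nonempty := Finset.card_pos.1 hk
  obtain ⟨j, hj⟩ : Sᶜ.Nonempty := by
    rw [← Finset.card_pos, Finset.card_compl, Fintype.card_fin]
    omega
  obtain ⟨x, hx, hmax⟩ := (S ×ˢ (Finset.univ : Finset Bool)).exists_max_image
    (fun x => f (p x)) (hS.product Finset.univ_nonempty)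
  obtain ⟨y, hy, hmin⟩ := (Sᶜ ×ˢ (Finset.univ : Finset Bool)).exists_min_image
    (fun x => f (p x)) (Finset.Nonempty.product ⟨j, hj⟩ Finset.univ_nonempty)
  simp only [Finset.mem_product, Finset.mem_compl, Finset.mem_univ, and_true] at hx hmax hy hmin
  have hxy := h x.1 hx y.1 hy x.2 y.2
  refine hp.not_separated hS (Finset.mem_compl.1 hj)
    (f.toAffineMap - AffineMap.const ℝ _ ((f (p x) + f (p y)) / 2)) (fun i hi b => ?_)
    fun i hi b => ?_
  · have := hmax (i, b) hi
    simp only [AffineMap.coe_sub, Pi.sub_apply, LinearMap.coe_toAffineMap, AffineMap.const_apply]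
    linarith
  · have := hmin (i, b) hi
    simp only [AffineMap.coe_sub, Pi.sub_apply, LinearMap.coe_toAffineMap, AffineMap.const_apply]
    linarith
end

section
/- Let d ≥ 2 and let v : {1,…,d−1} × {+,−} → ℝ^d be 2d−2 points all lying in a hyperplane H of ℝ^d, and let P be their convex hull. Suppose the nonempty proper exposed faces of P are exactly the sets conv{v(x) : x ∈ T} for nonempty sets T of indices containing at most one of (i,+), (i,−) for each i. Let y, z ∈ ℝ^d be points not in H such that the open segment from y to z meets the relative interior of P. Then the convex hull Q of the 2d points {v(x)} ∪ {y, z} has the analogous property with d pairs: the nonempty proper exposed faces of Q are exactly the sets conv({v(x) : x ∈ T} ∪ Z) where T contains at most one of (i,+), (i,−) for each i, Z ⊆ {y, z} has at most one element, and T ∪ Z is nonempty. In particular Q is a d-dimensional crosspolytope with pairs P_1, …, P_{d−1}, {y, z}. -/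
open Set

theorem mem_convexHull_zeros_of_nonpos {E : Type*} [AddCommGroup E] [Module ℝ E]
    {S : Set E} {f : E →ᵃ[ℝ] ℝ} (hf : ∀ s ∈ S, f s ≤ 0) {x : E} (hx : x ∈ convexHull ℝ S) :
    f x < 0 ∨ f x = 0 ∧ x ∈ convexHull ℝ {s ∈ S | f s = 0} := by
  suffices h : convexHull ℝ S ⊆ {x | f x < 0 ∨ f x = 0 ∧ x ∈ convexHull ℝ {s ∈ S | f s = 0}} from
    h hx
  refine convexHull_min (fun s hs => ?_) (convex_iff_forall_pos.2 ?_)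
  · rcases (hf s hs).lt_or_eq with h | h
    · exact Or.inl h
    · exact Or.inr ⟨h, subset_convexHull ℝ _ ⟨hs, h⟩⟩
  · intro u hu w hw a b ha hb hab
    have e : f (a • u + b • w) = a * f u + b * f w := by
      simpa using Convex.combo_affine_apply (f := f) (x := u) (y := w) hab
    simp only [mem_ofPred_eq] at hu hw ⊢
    rw [e]
    rcases hu with hu | ⟨hu, hu'⟩ <;> rcases hw with hw | ⟨hw, hw'⟩
    · left; nlinarith
    · left; nlinarith
    · left; nlinarith
    · exact Or.inr ⟨by simp [hu, hw], convex_convexHull ℝ _ hu' hw' ha.le hb.le hab⟩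

theorem nonpos_of_mem_convexHull {E : Type*} [AddCommGroup E] [Module ℝ E]
    {S : Set E} {f : E →ᵃ[ℝ] ℝ} (hf : ∀ s ∈ S, f s ≤ 0) {x : E} (hx : x ∈ convexHull ℝ S) :
    f x ≤ 0 := by
  rcases mem_convexHull_zeros_of_nonpos hf hx with h | h
  exacts [h.le, h.1.le]

theorem eq_zero_of_mem_convexHull_zeros {E : Type*} [AddCommGroup E] [Module ℝ E]
    {S : Set E} {f : E →ᵃ[ℝ] ℝ} {x : E} (hx : x ∈ convexHull ℝ {s ∈ S | f s = 0}) :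
    f x = 0 := by
  have h : convexHull ℝ {s ∈ S | f s = 0} ⊆ f ⁻¹' {0} :=
    convexHull_min (fun s hs => hs.2) ((convex_singleton (0 : ℝ)).affine_preimage f)
  exact h hx

/-- The nonempty exposed faces of a convex hull are cut out by the affine functionals that are
nonpositive on the generating set and vanish somewhere on it. -/
theorem isExposed_convexHull_and_nonempty_iff {E : Type*} [NormedAddCommGroup E] [NormedSpace ℝ E]
    [FiniteDimensional ℝ E] {S F : Set E} :
    IsExposed ℝ (convexHull ℝ S) F ∧ F.Nonempty ↔
      ∃ f : E →ᵃ[ℝ] ℝ, (∀ s ∈ S, f s ≤ 0) ∧ (∃ s ∈ S, f s = 0) ∧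
        F = convexHull ℝ {s ∈ S | f s = 0} := by
  constructor
  · rintro ⟨hF, hne⟩
    obtain ⟨l, hl⟩ := hF hne
    obtain ⟨x, hx⟩ := hne
    have hx' := hl ▸ hx
    let f : E →ᵃ[ℝ] ℝ := l.toLinearMap.toAffineMap - AffineMap.const ℝ E (l x)
    have hf : ∀ u, f u = l u - l x := fun u => by simp [f]
    have hS : ∀ s ∈ S, f s ≤ 0 := fun s hs => by
      rw [hf]
      linarith [hx'.2 s (subset_convexHull ℝ S hs)]
    have hFe : F = convexHull ℝ {s ∈ S | f s = 0} := by
      rw [hl]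
      ext u
      constructor
      · rintro ⟨hu, hmax⟩
        rcases mem_convexHull_zeros_of_nonpos hS hu with h | h
        · rw [hf] at h
          linarith [hmax x hx'.1]
        · exact h.2
      · intro hu
        have h0 := eq_zero_of_mem_convexHull_zeros hu
        rw [hf] at h0
        exact ⟨convexHull_mono (sep_subset _ _) hu, fun w hw => by linarith [hx'.2 w hw]⟩
    refine ⟨f, hS, ?_, hFe⟩
    obtain ⟨s, hs⟩ := convexHull_nonempty_iff.1 ⟨x, hFe ▸ hx⟩
    exact ⟨s, hs⟩
  · rintro ⟨f, hS, ⟨s, hs, hs0⟩, rfl⟩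
    have hs' : s ∈ convexHull ℝ {s ∈ S | f s = 0} := subset_convexHull ℝ _ ⟨hs, hs0⟩
    refine ⟨fun _ => ⟨f.linear.toContinuousLinearMap, ?_⟩, s, hs'⟩
    have hf : ∀ u w, f.linear u ≤ f.linear w ↔ f u ≤ f w := fun u w => by
      rw [← sub_nonpos, ← map_sub, ← vsub_eq_sub, f.linearMap_vsub, vsub_eq_sub, sub_nonpos]
    ext u
    simp only [LinearMap.coe_toContinuousLinearMap', hf, mem_ofPred_eq]
    constructor
    · intro hu
      rw [eq_zero_of_mem_convexHull_zeros hu]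
      exact ⟨convexHull_mono (sep_subset _ _) hu, fun w hw => nonpos_of_mem_convexHull hS hw⟩
    · rintro ⟨hu, hmax⟩
      rcases mem_convexHull_zeros_of_nonpos hS hu with h | h
      · linarith [hmax s (subset_convexHull ℝ _ hs)]
      · exact h.2

theorem AffineMap.eq_zero_of_nonpos_of_mem_intrinsicInterior {E : Type*} [NormedAddCommGroup E]
    [NormedSpace ℝ E] {C : Set E} {f : E →ᵃ[ℝ] ℝ} (hf : ∀ x ∈ C, f x ≤ 0) {p : E}
    (hp : p ∈ intrinsicInterior ℝ C) (hfp : f p = 0) {x : E} (hx : x ∈ C) : f x = 0 := by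
  obtain ⟨p', hp', rfl⟩ := mem_intrinsicInterior.1 hp
  have hx' : x ∈ affineSpan ℝ C := subset_affineSpan ℝ C hx
  let γ : ℝ → affineSpan ℝ C := fun t =>
    ⟨AffineMap.lineMap x (p' : E) t, AffineMap.lineMap_mem t hx' p'.2⟩
  have hγ : Continuous γ := by
    refine Continuous.subtype_mk ?_ _
    exact AffineMap.lineMap_continuous
  have hγ1 : γ 1 = p' := by ext; simp [γ]
  have hev : ∀ᶠ t in nhds (1 : ℝ), γ t ∈ ((↑) : affineSpan ℝ C → E) ⁻¹' C :=
    hγ.continuousAt.eventually (by rw [hγ1]; exact mem_interior_iff_mem_nhds.1 hp')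
  obtain ⟨t, ht, ht1⟩ := ((hev.filter_mono nhdsWithin_le_nhds).and
    (self_mem_nhdsWithin (s := Ioi (1 : ℝ)))).exists
  have h1 := hf _ ht
  have h2 : f (γ t : E) = (1 - t) * f x := by
    simp only [γ, AffineMap.apply_lineMap, hfp]
    simp [AffineMap.lineMap_apply]
    ring
  rw [h2] at h1
  have h3 := hf x hx
  have : (1 : ℝ) < t := ht1
  nlinarith

theorem sep_range_union_pair {ι E : Type*} (v : ι → E) (y z : E) (q : E → Prop) :
    {s ∈ range v ∪ {y, z} | q s} = {s ∈ range v | q s} ∪ {w ∈ ({y, z} : Set E) | q w} := by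
  ext
  simp only [mem_ofPred_eq, mem_union]
  tauto

theorem convexHull_union_congr_left {E : Type*} [AddCommGroup E] [Module ℝ E] {A B : Set E}
    (h : convexHull ℝ A = convexHull ℝ B) (Z : Set E) :
    convexHull ℝ (A ∪ Z) = convexHull ℝ (B ∪ Z) := by
  rw [← convexHull_convexHull_union_left, h, convexHull_convexHull_union_left]

/-- The nonempty proper exposed faces of a bipyramid with base `convexHull ℝ S` and apexes
`y`, `z`, described in terms of affine functionals. -/
theorem isExposed_bipyramid_iff {E : Type*} [NormedAddCommGroup E] [NormedSpace ℝ E]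
    [FiniteDimensional ℝ E] {ι : Type*} {v : ι → E} {g : E →ᵃ[ℝ] ℝ}
    (hv : ∀ i, g (v i) = 0) {y z : E} (hy : g y ≠ 0)
    (hseg : (openSegment ℝ y z ∩ intrinsicInterior ℝ (convexHull ℝ (range v))).Nonempty)
    {F : Set E} :
    (IsExposed ℝ (convexHull ℝ (range v ∪ {y, z})) F ∧ F.Nonempty ∧
        F ≠ convexHull ℝ (range v ∪ {y, z})) ↔
      ∃ G Z : Set E, (G = ∅ ∨ IsExposed ℝ (convexHull ℝ (range v)) G ∧ G.Nonempty ∧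
          G ≠ convexHull ℝ (range v)) ∧ Z ⊆ {y, z} ∧ ¬ (y ∈ Z ∧ z ∈ Z) ∧
        (G.Nonempty ∨ Z.Nonempty) ∧ F = convexHull ℝ (G ∪ Z) := by
  obtain ⟨p, ⟨a, b, ha, hb, hab, hpe⟩, hp⟩ := hseg
  have hcombo (f : E →ᵃ[ℝ] ℝ) : f p = a * f y + b * f z := by
    rw [← hpe]
    simpa using Convex.combo_affine_apply (f := f) (x := y) (y := z) hab
  have hpP : p ∈ convexHull ℝ (range v) := intrinsicInterior_subset hp
  have hpQ : p ∈ convexHull ℝ (range v ∪ {y, z}) := convexHull_mono subset_union_left hpP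
  have hconst {f : E →ᵃ[ℝ] ℝ} (hf : ∀ s ∈ range v, f s ≤ 0) (hfp : f p = 0) :
      ∀ s ∈ range v, f s = 0 := fun s hs =>
    AffineMap.eq_zero_of_nonpos_of_mem_intrinsicInterior
      (fun x hx => nonpos_of_mem_convexHull hf hx) hp hfp (subset_convexHull ℝ _ hs)
  have hgp : g p = 0 :=
    convexHull_min (s := range v) (t := g ⁻¹' {0}) (by rintro _ ⟨i, rfl⟩; exact hv i)
      ((convex_singleton (0 : ℝ)).affine_preimage g) hpP
  rw [← and_assoc, isExposed_convexHull_and_nonempty_iff]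
  constructor
  · rintro ⟨⟨f, hf, ⟨s, hs, hs0⟩, rfl⟩, hne⟩
    have hfv : ∀ s ∈ range v, f s ≤ 0 := fun s hs => hf s (Or.inl hs)
    have hfy : f y ≤ 0 := hf y (by simp)
    have hfz : f z ≤ 0 := hf z (by simp)
    have hfp : f p ≠ 0 := fun h => hne <| by
      congr 1
      refine Subset.antisymm (sep_subset _ _) fun s hs => ⟨hs, ?_⟩
      have := hcombo f
      rcases hs with hs | rfl | rfl
      · exact hconst hfv h s hs
      · nlinarith
      · nlinarith
    refine ⟨convexHull ℝ {s ∈ range v | f s = 0}, {w ∈ ({y, z} : Set E) | f w = 0}, ?_,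
      sep_subset _ _, fun h => hfp ?_, ?_, ?_⟩
    · rcases {s ∈ range v | f s = 0}.eq_empty_or_nonempty with h | h
      · exact Or.inl (by rw [h, convexHull_empty])
      · refine Or.inr (and_assoc.1 ⟨isExposed_convexHull_and_nonempty_iff.2 ⟨f, hfv, h, rfl⟩, ?_⟩)
        intro hG
        exact hfp (eq_zero_of_mem_convexHull_zeros (hG ▸ hpP))
    · rw [hcombo, h.1.2, h.2.2]
      simp
    · rcases hs with hs | hs
      · exact Or.inl ⟨s, subset_convexHull ℝ _ ⟨hs, hs0⟩⟩
      · exact Or.inr ⟨s, hs, hs0⟩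
    · rw [convexHull_convexHull_union_left, sep_range_union_pair]
  · rintro ⟨G, Z, hG, hZ, hyz, hne, rfl⟩
    suffices h : ∃ f : E →ᵃ[ℝ] ℝ, (∀ s ∈ range v, f s ≤ 0) ∧ f p < 0 ∧
        convexHull ℝ {s ∈ range v | f s = 0} = G by
      obtain ⟨f, hfv, hfp, rfl⟩ := h
      /- Adding a multiple of `g` to `f` prescribes the value at `y` without changing `f` on the
      base; the value at `z` is then determined by the value at `p`. -/
      have htilt (c : ℝ) : ∃ k : E →ᵃ[ℝ] ℝ, (∀ i, k (v i) = f (v i)) ∧ k p = f p ∧ k y = c :=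
        ⟨f + ((c - f y) / g y) • g, by simp [hv], by simp [hgp], by simp [hy]⟩
      obtain ⟨k, hkv, hkp, hky, hkz, hkZ⟩ : ∃ k : E →ᵃ[ℝ] ℝ, (∀ i, k (v i) = f (v i)) ∧
          k p = f p ∧ k y ≤ 0 ∧ k z ≤ 0 ∧ {w ∈ ({y, z} : Set E) | k w = 0} = Z := by
        have hZ' (k : E →ᵃ[ℝ] ℝ) (h1 : k y = 0 ↔ y ∈ Z) (h2 : k z = 0 ↔ z ∈ Z) :
            {w ∈ ({y, z} : Set E) | k w = 0} = Z := by
          ext w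
          constructor
          · rintro ⟨rfl | rfl, h⟩
            exacts [h1.1 h, h2.1 h]
          · intro h
            refine ⟨hZ h, ?_⟩
            rcases hZ h with rfl | rfl
            exacts [h1.2 h, h2.2 h]
        by_cases hyZ : y ∈ Z
        · obtain ⟨k, h1, h2, h3⟩ := htilt 0
          have h4 : k z < 0 := by
            have := hcombo k
            rw [h3, h2] at this
            nlinarith
          exact ⟨k, h1, h2, h3.le, h4.le, hZ' k (by tauto) (by have := h4.ne; tauto)⟩
        by_cases hzZ : z ∈ Z
        · obtain ⟨k, h1, h2, h3⟩ := htilt (f p / a)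
          have h4 : k y < 0 := h3 ▸ div_neg_of_neg_of_pos hfp ha
          have h5 : k z = 0 := by
            have := hcombo k
            rw [h3, h2, mul_div_cancel₀ _ ha.ne'] at this
            have : b * k z = 0 := by linarith
            exact (mul_eq_zero.1 this).resolve_left hb.ne'
          exact ⟨k, h1, h2, h4.le, h5.le, hZ' k (by have := h4.ne; tauto) (by tauto)⟩
        · obtain ⟨k, h1, h2, h3⟩ := htilt (f p)
          have h4 : k z < 0 := by
            have := hcombo k
            rw [h3, h2] at this
            have : b * k z = b * f p := by linear_combination -this - f p * hab
            rwa [mul_left_cancel₀ hb.ne' this]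
          rw [← h3] at hfp
          exact ⟨k, h1, h2, hfp.le, h4.le, hZ' k (by have := hfp.ne; tauto)
            (by have := h4.ne; tauto)⟩
      have hsep : {s ∈ range v | k s = 0} = {s ∈ range v | f s = 0} := by
        ext s
        refine and_congr_right ?_
        rintro ⟨i, rfl⟩
        rw [hkv]
      have hQ : convexHull ℝ (convexHull ℝ {s ∈ range v | f s = 0} ∪ Z) =
          convexHull ℝ {s ∈ range v ∪ {y, z} | k s = 0} := by
        rw [convexHull_convexHull_union_left, sep_range_union_pair, hkZ, hsep]
      refine ⟨⟨k, ?_, ?_, hQ⟩, fun h => ?_⟩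
      · rintro s (⟨i, rfl⟩ | rfl | rfl)
        exacts [hkv i ▸ hfv _ ⟨i, rfl⟩, hky, hkz]
      · have hne' : (convexHull ℝ {s ∈ range v ∪ {y, z} | k s = 0}).Nonempty := by
          rw [← hQ, convexHull_nonempty_iff]
          exact union_nonempty.2 hne
        obtain ⟨s, hs⟩ := convexHull_nonempty_iff.1 hne'
        exact ⟨s, hs⟩
      · rw [hQ] at h
        exact (hkp ▸ hfp).ne (eq_zero_of_mem_convexHull_zeros (h ▸ hpQ))
    rcases hG with rfl | ⟨hG, hGne, hGP⟩
    · exact ⟨AffineMap.const ℝ E (-1), by simp, by simp, by simp⟩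
    · obtain ⟨f, hf, -, rfl⟩ := isExposed_convexHull_and_nonempty_iff.1 ⟨hG, hGne⟩
      refine ⟨f, hf, lt_of_le_of_ne (nonpos_of_mem_convexHull hf hpP) fun h => hGP ?_, rfl⟩
      congr 1
      exact Subset.antisymm (sep_subset _ _) fun s hs => ⟨hs, hconst hf h s hs⟩

/-- Let `d ≥ 2` and let `v` be `2d - 2` points of `ℝ^d`, indexed by
`Fin (d-1) × Bool`, all lying in a hyperplane `H = {x | g x = 0}` (`g` an affine
functional with nonzero linear part), with convex hull `P`. Suppose the nonempty
proper exposed faces of `P` are exactly the convex hulls of the sets of points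
indexed by nonempty index sets `T` containing at most one of `(i, +)`, `(i, -)`
for each `i`. Let `y, z` be points not in `H` such that the open segment from
`y` to `z` meets the relative interior of `P`. Then the convex hull `Q` of the
`2d` points has the analogous property with `d` pairs `P_1, …, P_{d-1}, {y, z}`:
its nonempty proper exposed faces are exactly the sets
`conv ({v x : x ∈ T} ∪ Z)` where `T` contains at most one member of each pair,
`Z ⊆ {y, z}` has at most one element, and `T ∪ Z` is nonempty. In particular `Q`
is a `d`-dimensional crosspolytope. -/
theorem stmt_14 (d : ℕ) (hd : 2 ≤ d)
    (v : Fin (d - 1) × Bool → (Fin d → ℝ))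
    (g : (Fin d → ℝ) →ᵃ[ℝ] ℝ) (hg : g.linear ≠ 0)
    (hvH : ∀ x, g (v x) = 0)
    (y z : Fin d → ℝ) (hy : g y ≠ 0) (hz : g z ≠ 0)
    (hseg : (openSegment ℝ y z ∩
        intrinsicInterior ℝ (convexHull ℝ (Set.range v))).Nonempty)
    (hP : ∀ F : Set (Fin d → ℝ),
      (IsExposed ℝ (convexHull ℝ (Set.range v)) F ∧ F.Nonempty ∧
          F ≠ convexHull ℝ (Set.range v)) ↔
        ∃ T : Set (Fin (d - 1) × Bool), T.Nonempty ∧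
          (∀ i, ¬ ((i, true) ∈ T ∧ (i, false) ∈ T)) ∧
          F = convexHull ℝ (v '' T)) :
    ∀ F : Set (Fin d → ℝ),
      (IsExposed ℝ (convexHull ℝ (Set.range v ∪ {y, z})) F ∧ F.Nonempty ∧
          F ≠ convexHull ℝ (Set.range v ∪ {y, z})) ↔
        ∃ (T : Set (Fin (d - 1) × Bool)) (Z : Set (Fin d → ℝ)),
          (∀ i, ¬ ((i, true) ∈ T ∧ (i, false) ∈ T)) ∧
          Z ⊆ {y, z} ∧ ¬ (y ∈ Z ∧ z ∈ Z) ∧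
          (T.Nonempty ∨ Z.Nonempty) ∧
          F = convexHull ℝ (v '' T ∪ Z) := by
  intro F
  rw [isExposed_bipyramid_iff hvH hy hseg]
  constructor
  · rintro ⟨G, Z, hG, hZ, hyz, hne, rfl⟩
    rcases hG with rfl | hG
    · exact ⟨∅, Z, by simp, hZ, hyz, by simpa using hne, by simp⟩
    · obtain ⟨T, hT, hT', rfl⟩ := (hP G).1 hG
      exact ⟨T, Z, hT', hZ, hyz, Or.inl hT, convexHull_convexHull_union_left _ _⟩
  · rintro ⟨T, Z, hT', hZ, hyz, hne, rfl⟩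
    refine ⟨convexHull ℝ (v '' T), Z, ?_, hZ, hyz, by simpa using hne,
      (convexHull_convexHull_union_left _ _).symm⟩
    rcases T.eq_empty_or_nonempty with rfl | hT
    · exact Or.inl (by simp)
    · exact Or.inr ((hP _).2 ⟨T, hT, hT', rfl⟩)
end

section
/- Let d ≥ 2, let O be an acyclic orientation of X_d, and let π be its pair sequence, with blocks listed in increasing order of their smaller elements. Then O has a unique source if and only if the first block of π is not {1, 2}, and O has a unique sink if and only if the last block of π is not {2d−1, 2d}. -/
/-- An injective labeling of the crosspolytope graph by numbers below `2 * d` takes every such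
number as a value. -/
theorem exists_label_eq {d : ℕ} {ℓ : Fin d × Bool → ℕ} (hinj : Function.Injective ℓ)
    (hlt : ∀ x, ℓ x < 2 * d) {k : ℕ} (hk : k < 2 * d) : ∃ x, ℓ x = k := by
  have himage : Finset.univ.image ℓ = Finset.range (2 * d) := by
    apply Finset.eq_of_subset_of_card_le
    · intro n hn
      obtain ⟨x, -, rfl⟩ := Finset.mem_image.mp hn
      exact Finset.mem_range.mpr (hlt x)
    · rw [Finset.card_image_of_injective _ hinj]
      simp [mul_comm]
  have hmem : k ∈ Finset.univ.image ℓ := himage ▸ Finset.mem_range.mpr hk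
  simpa using hmem

/-- Two distinct vertices lie in the same pair iff some pair carries exactly their labels. -/
theorem exists_pair_labels_iff {d : ℕ} {ℓ : Fin d × Bool → ℕ} (hinj : Function.Injective ℓ)
    {a b : Fin d × Bool} (hab : a ≠ b) :
    (∃ i : Fin d, ({ℓ (i, true), ℓ (i, false)} : Finset ℕ) = {ℓ a, ℓ b}) ↔ a.1 = b.1 := by
  constructor
  · rintro ⟨i, hi⟩
    have hfst : ∀ x, ℓ x ∈ ({ℓ a, ℓ b} : Finset ℕ) → x.1 = i := by
      intro x hx
      rw [← hi, Finset.mem_insert, Finset.mem_singleton] at hx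
      rcases hx with hx | hx <;> rw [hinj hx]
    rw [hfst a (by simp), hfst b (by simp)]
  · obtain ⟨i, s⟩ := a
    obtain ⟨j, t⟩ := b
    rintro rfl
    refine ⟨i, ?_⟩
    cases s <;> cases t <;> simp_all [Finset.pair_comm]

/-- An orientation of the crosspolytope graph with a compatible labeling has a unique source iff
the two smallest labels do not form a pair. -/
theorem existsUnique_source_iff {d : ℕ} {O : Fin d × Bool → Fin d × Bool → Prop}
    (hor : IsOrientation XAdj O) {ℓ : Fin d × Bool → ℕ} (hℓ : IsLabeling O ℓ)
    {a b : Fin d × Bool} (ha : ℓ a = 0) (hb : ℓ b = 1) :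
    (∃! u : Fin d × Bool, ∀ y, ¬ O y u) ↔ a.1 ≠ b.1 := by
  obtain ⟨hinj, hlt, hmono⟩ := hℓ
  have hab : a ≠ b := by rintro rfl; omega
  have hedge : ∀ x y : Fin d × Bool, x.1 ≠ y.1 → ℓ x < ℓ y → O x y := fun x y hne hxy =>
    (hor.2 x y hne).mpr fun h => (hmono y x h).not_gt hxy
  have hsource : ∀ y, ¬ O y a := fun y h => by
    have := hmono y a h
    omega
  constructor
  · rintro ⟨u, -, hu⟩ hfst
    refine hab ((hu a hsource).trans (hu b fun y h => ?_).symm)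
    have hy : y = a := hinj (by have := hmono y b h; omega)
    exact hor.1 y b h (hy ▸ hfst)
  · intro hne
    refine ⟨a, hsource, fun u hu => ?_⟩
    by_contra hua
    have hu0 : ℓ u ≠ 0 := fun h => hua (hinj (h.trans ha.symm))
    have hfst : a.1 = u.1 := by
      by_contra h
      exact hu a (hedge a u h (by omega))
    have hub : ℓ u ≠ 1 := fun h => hne (hfst.trans (by rw [hinj (h.trans hb.symm)]))
    exact hu b (hedge b u (fun h => hne (hfst.trans h.symm)) (by omega))

/-- Reversing every edge of an orientation gives an orientation. -/
theorem IsOrientation.reverse {d : ℕ} {O : Fin d × Bool → Fin d × Bool → Prop}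
    (hor : IsOrientation XAdj O) : IsOrientation XAdj fun x y => O y x :=
  ⟨fun v w h => (hor.1 w v h).symm, fun v w h => hor.2 w v h.symm⟩

/-- Complementing the labels gives a labeling compatible with the reversed orientation. -/
theorem IsLabeling.reverse {d : ℕ} {O : Fin d × Bool → Fin d × Bool → Prop}
    {ℓ : Fin d × Bool → ℕ} (hℓ : IsLabeling O ℓ) :
    IsLabeling (fun x y => O y x) fun x => 2 * d - 1 - ℓ x := by
  obtain ⟨hinj, hlt, hmono⟩ := hℓ
  refine ⟨fun x y h => hinj ?_, fun x => ?_, fun x y h => ?_⟩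
  · have := hlt x
    have := hlt y
    dsimp only at h
    omega
  · have := hlt x
    dsimp only
    omega
  · have := hlt x
    have := hmono y x h
    dsimp only
    omega

/-- Let `d ≥ 2`, let `O` be an acyclic orientation of `X_d` and let `π` be its
pair sequence, given by a compatible labeling `ℓ` (written `0`-based, so the
labels are `{0, …, 2d-1}`), with blocks listed in increasing order of their
smaller elements. Then `O` has a unique source iff the first block of `π` is not
`{1, 2}` (`0`-based: no pair has label set `{0, 1}`), and `O` has a unique sink
iff the last block of `π` is not `{2d-1, 2d}` (`0`-based: no pair has label set
`{2d-2, 2d-1}`). -/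
theorem stmt_16 (d : ℕ) (hd : 2 ≤ d) (O : Fin d × Bool → Fin d × Bool → Prop)
    (hor : IsOrientation XAdj O) (hac : IsAcyclic O)
    (ℓ : Fin d × Bool → ℕ) (hℓ : IsLabeling O ℓ) :
    ((∃! u : Fin d × Bool, ∀ y, ¬ O y u) ↔
      ¬ ∃ i : Fin d, ({ℓ (i, true), ℓ (i, false)} : Finset ℕ) = {0, 1}) ∧
    ((∃! v : Fin d × Bool, ∀ y, ¬ O v y) ↔
      ¬ ∃ i : Fin d, ({ℓ (i, true), ℓ (i, false)} : Finset ℕ) =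
        {2 * d - 2, 2 * d - 1}) := by
  obtain ⟨hinj, hlt, -⟩ := id hℓ
  obtain ⟨a, ha⟩ := exists_label_eq hinj hlt (k := 0) (by omega)
  obtain ⟨b, hb⟩ := exists_label_eq hinj hlt (k := 1) (by omega)
  obtain ⟨p, hp⟩ := exists_label_eq hinj hlt (k := 2 * d - 2) (by omega)
  obtain ⟨q, hq⟩ := exists_label_eq hinj hlt (k := 2 * d - 1) (by omega)
  have hab : a ≠ b := by rintro rfl; omega
  have hpq : p ≠ q := by rintro rfl; omega
  constructor
  · rw [existsUnique_source_iff hor hℓ ha hb, ← ha, ← hb, exists_pair_labels_iff hinj hab]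
  · rw [existsUnique_source_iff hor.reverse hℓ.reverse (a := q) (b := p)
      (by omega) (by omega), ← hp, ← hq,
      exists_pair_labels_iff hinj hpq, ne_comm]
end

section
/- Let d ≥ 1, let O be an acyclic orientation of X_d, and let π be its pair sequence, with blocks listed in increasing order of their smaller elements. Then the following are equivalent: (a) there is a set S of vertices with ∅ ≠ S ≠ V(X_d) which is a union of pairs P_i and such that every edge between a vertex x ∈ S and a vertex y ∉ S is directed from x to y; (b) there exists k with 0 < k < d such that the union of the first k blocks of π equals {1,…,2k} (i.e., π is bad). -/
/-- A compatible labeling takes every value in `{0, …, 2d-1}`. -/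
theorem IsLabeling.exists_eq {d : ℕ} {O : Fin d × Bool → Fin d × Bool → Prop}
    {ℓ : Fin d × Bool → ℕ} (hℓ : IsLabeling O ℓ) {n : ℕ} (hn : n < 2 * d) :
    ∃ x, ℓ x = n := by
  have himage : Finset.univ.image ℓ = Finset.range (2 * d) := by
    apply Finset.eq_of_subset_of_card_le
    · intro m hm
      obtain ⟨x, -, rfl⟩ := Finset.mem_image.1 hm
      exact Finset.mem_range.2 (hℓ.2.1 x)
    · rw [Finset.card_image_of_injective _ hℓ.1]
      simp [mul_comm]
  have hmem : n ∈ Finset.univ.image ℓ := himage ▸ Finset.mem_range.2 hn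
  simpa using hmem

/-- If the labels on `A` are smaller than those off `A`, then `A` carries the
`#A` smallest labels. -/
theorem IsLabeling.lt_card_iff {d : ℕ} {O : Fin d × Bool → Fin d × Bool → Prop}
    {ℓ : Fin d × Bool → ℕ} (hℓ : IsLabeling O ℓ) {A : Finset (Fin d × Bool)}
    (hA : ∀ x ∈ A, ∀ y ∉ A, ℓ x < ℓ y) (x : Fin d × Bool) :
    ℓ x < A.card ↔ x ∈ A := by
  rw [← Finset.card_image_of_injective A hℓ.1]
  constructor
  · contrapose!
    intro hx
    rw [← Finset.card_range (ℓ x)]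
    apply Finset.card_le_card
    intro m hm
    obtain ⟨y, hy, rfl⟩ := Finset.mem_image.1 hm
    exact Finset.mem_range.2 (hA y hy x hx)
  · intro hx
    rw [← Nat.succ_le_iff, ← Finset.card_range (ℓ x).succ]
    apply Finset.card_le_card
    intro m hm
    have hmx : m ≤ ℓ x := Nat.lt_succ_iff.1 (Finset.mem_range.1 hm)
    obtain ⟨y, rfl⟩ := hℓ.exists_eq (hmx.trans_lt (hℓ.2.1 x))
    refine Finset.mem_image_of_mem ℓ ?_
    by_contra hy
    exact (hA x hx y hy).not_ge hmx

/-- Let `d ≥ 1`, let `O` be an acyclic orientation of `X_d`, and let `π` be its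
pair sequence, given by a compatible labeling `ℓ` (written `0`-based), with
blocks listed in increasing order of their smaller elements. The following are
equivalent:
(a) there is a proper nonempty set `S` of vertices which is a union of pairs
`P_i` and such that every edge between `x ∈ S` and `y ∉ S` is directed from `x`
to `y`;
(b) there exists `k` with `0 < k < d` such that the union of the first `k`
blocks of `π` equals `{1, …, 2k}` (`0`-based: every block lies entirely inside
or entirely outside `{0, …, 2k-1}`), i.e. `π` is bad. -/
theorem stmt_17 (d : ℕ) (hd : 1 ≤ d) (O : Fin d × Bool → Fin d × Bool → Prop)
    (hor : IsOrientation XAdj O) (hac : IsAcyclic O)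
    (ℓ : Fin d × Bool → ℕ) (hℓ : IsLabeling O ℓ) :
    (∃ S : Set (Fin d × Bool), S.Nonempty ∧ S ≠ Set.univ ∧
        (∀ i : Fin d, ((i, true) ∈ S ↔ (i, false) ∈ S)) ∧
        ∀ x ∈ S, ∀ y ∉ S, XAdj x y → O x y) ↔
    (∃ k : ℕ, 0 < k ∧ k < d ∧
        ∀ i : Fin d, (ℓ (i, true) < 2 * k ↔ ℓ (i, false) < 2 * k)) := by
  classical
  constructor
  · rintro ⟨S, ⟨x, hx⟩, hne, hpair, hS⟩
    have hmem : ∀ y : Fin d × Bool, y ∈ S ↔ (y.1, true) ∈ S := by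
      rintro ⟨i, _ | _⟩
      · exact (hpair i).symm
      · exact Iff.rfl
    obtain ⟨z, hz⟩ := (Set.ne_univ_iff_exists_notMem S).1 hne
    set T : Finset (Fin d) := {i | (i, true) ∈ S} with hT
    have hA : ∀ y, y ∈ T ×ˢ (Finset.univ : Finset Bool) ↔ y ∈ S := by
      intro y
      simp [hT, hmem y]
    have hlt : ∀ y, ℓ y < 2 * T.card ↔ y ∈ S := by
      intro y
      rw [← hA, ← hℓ.lt_card_iff (A := T ×ˢ Finset.univ), Finset.card_product,
        Finset.card_univ, Fintype.card_bool, mul_comm]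
      intro u hu v hv
      rw [hA] at hu hv
      refine hℓ.2.2 u v (hS u hu v hv fun huv => hv ?_)
      rwa [hmem, ← huv, ← hmem]
    refine ⟨T.card, ?_, ?_, fun i => ?_⟩
    · have := (hlt x).2 hx
      omega
    · have := (hlt z).not.2 hz
      have := hℓ.2.1 z
      omega
    · rw [hlt, hlt, hpair]
  · rintro ⟨k, hk, hkd, hpair⟩
    obtain ⟨x, hx⟩ := hℓ.exists_eq (n := 0) (by omega)
    obtain ⟨z, hz⟩ := hℓ.exists_eq (n := 2 * k) (by omega)
    refine ⟨{y | ℓ y < 2 * k}, ⟨x, ?_⟩, ?_, hpair, ?_⟩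
    · simp [hx, hk]
    · exact (Set.ne_univ_iff_exists_notMem _).2 ⟨z, by simp [hz]⟩
    · intro u hu v hv huv
      refine (hor.2 u v huv).2 fun hvu => hv ?_
      exact (hℓ.2.2 v u hvu).trans hu
end
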